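/- arXiv:1312.7873 — 2 statements merged into one kernel-verified Lean document; each statement's English description precedes it below -/
import Mathlib

section
/- Let Pₙ(z,w) be the probability that a simple symmetric random walk on ℤ⁶ started at z is at w after n steps, and let b₀ ≈ 1.942 be the unique positive solution of 6b²/(sinh b)² = b. Then for all n ≥ 1 and all z, w ∈ ℤ⁶, Pₙ(z,w) ≤ (3π/n)³ exp(-b₀ ‖z-w‖₂² / (2n)). -/
open Real

/-- The `n`-step transition probability of the simple symmetric random walk on `ℤ⁶`:
at each step the walk moves to one of the 12 nearest neighbors with probability 1/12. -/
noncomputable def rw6 : ℕ → (Fin 6 → ℤ) → (Fin 6 → ℤ) → ℝ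
  | 0, z, w => if z = w then 1 else 0
  | n + 1, z, w =>
      (1 / 12) * ∑ j : Fin 6,
        (rw6 n (Function.update z j (z j + 1)) w + rw6 n (Function.update z j (z j - 1)) w)

open MeasureTheory

lemma aux_fact (k : ℕ) : 6 ^ k * k.factorial ≤ 6 * (2 * k).factorial := by
  rcases Nat.eq_zero_or_pos k with rfl | hk
  · simp
  induction k, hk using Nat.le_induction with
  | base => simp [Nat.factorial]
  | succ k hk ih =>
    have e : 2 * (k + 1) = 2 * k + 1 + 1 := by ring
    rw [e, Nat.factorial_succ (2 * k + 1), Nat.factorial_succ (2 * k), Nat.factorial_succ k, pow_succ]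
    calc 6 ^ k * 6 * ((k + 1) * k.factorial) = (6 * (k + 1)) * (6 ^ k * k.factorial) := by ring
      _ ≤ ((2 * k + 1 + 1) * (2 * k + 1)) * (6 * (2 * k).factorial) := by
          apply Nat.mul_le_mul _ ih
          nlinarith
      _ = _ := by ring

lemma aux_cosh (x : ℝ) : Real.cosh x ≤ 6 * Real.exp (x ^ 2 / 6) - 5 := by
  have h1 := Real.hasSum_cosh x
  have h2 : HasSum (fun k : ℕ => (x ^ 2 / 6) ^ k / (k.factorial : ℝ)) (Real.exp (x ^ 2 / 6)) := by
    rw [Real.exp_eq_exp_ℝ]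
    exact NormedSpace.expSeries_div_hasSum_exp (x ^ 2 / 6)
  have h3 := (h2.mul_left 6).sub h1
  have h4 : ∀ k : ℕ, 0 ≤ 6 * ((x ^ 2 / 6) ^ k / (k.factorial : ℝ)) - x ^ (2 * k) / ((2 * k).factorial : ℝ) := by
    intro k
    have hf : ((6 : ℝ) ^ k * k.factorial) ≤ 6 * ((2 * k).factorial : ℝ) := by
      exact_mod_cast aux_fact k
    have p1 : (0 : ℝ) < k.factorial := by positivity
    have p2 : (0 : ℝ) < (2 * k).factorial := by positivity
    have p3 : 0 ≤ x ^ (2 * k) := by rw [pow_mul]; positivity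
    rw [sub_nonneg, div_pow, ← pow_mul, div_div, ← mul_div_assoc, div_le_div_iff₀ p2 (by positivity)]
    nlinarith
  have h5 := le_hasSum h3 0 (fun k _ => h4 k)
  simp at h5
  linarith

lemma aux_sum {ι : Type*} (s : Finset ι) (t : ι → ℝ) (ht : ∀ i, 0 ≤ t i) :
    ∑ i ∈ s, (Real.exp (t i) - 1) ≤ Real.exp (∑ i ∈ s, t i) - 1 := by
  classical
  induction s using Finset.induction_on with
  | empty => simp
  | insert a s ha ih =>
    rw [Finset.sum_insert ha, Finset.sum_insert ha, Real.exp_add]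
    have h1 : 1 ≤ Real.exp (t a) := Real.one_le_exp (ht a)
    have h2 : 1 ≤ Real.exp (∑ i ∈ s, t i) := Real.one_le_exp (Finset.sum_nonneg fun i _ => ht i)
    nlinarith

lemma aux_phi (θ : Fin 6 → ℝ) :
    (∑ j, Real.cosh (θ j)) / 6 ≤ Real.exp ((∑ j, θ j ^ 2) / 6) := by
  have h1 : ∑ j, Real.cosh (θ j) ≤ ∑ j, (6 * (Real.exp (θ j ^ 2 / 6) - 1) + 1) := by
    apply Finset.sum_le_sum
    intro j _
    linarith [aux_cosh (θ j)]
  have h2 := aux_sum Finset.univ (fun j => θ j ^ 2 / 6) (fun j => by positivity)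
  rw [Finset.sum_add_distrib, ← Finset.mul_sum] at h1
  rw [← Finset.sum_div] at h2
  simp at h1 h2
  linarith

lemma aux_b (b : ℝ) (hb₀ : 0 < b) (hb : 6 * b ^ 2 / (Real.sinh b) ^ 2 = b) : b ≤ 2 := by
  by_contra! h
  have hs : 0 < Real.sinh b := Real.sinh_pos_iff.2 hb₀
  rw [div_eq_iff (by positivity)] at hb
  have h6 : 6 * b = Real.sinh b ^ 2 := by
    have : b * (6 * b) = b * Real.sinh b ^ 2 := by linarith
    exact mul_left_cancel₀ hb₀.ne' this
  have h1 := Real.hasSum_sinh b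
  have h2 := sum_le_hasSum (Finset.range 3) (fun i _ => by positivity) h1
  simp [Finset.sum_range_succ, Nat.factorial] at h2
  have h3 : b * (9 / 5) ≤ Real.sinh b := by
    have : 4 ≤ b ^ 2 := by nlinarith
    have h5 : b * 4 ≤ b ^ 3 := by nlinarith
    have h7 : b * 16 ≤ b ^ 5 := by
      have : b ^ 5 = b ^ 3 * b ^ 2 := by ring
      nlinarith
    linarith
  nlinarith

noncomputable def muI : Measure ℝ := volume.restrict (Set.Ioc (-π) π)

instance : IsFiniteMeasure muI := by unfold muI; infer_instance

noncomputable def muB : Measure (Fin 6 → ℝ) := Measure.pi (fun _ => muI)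

instance : IsFiniteMeasure muB := by unfold muB; infer_instance

noncomputable def GG (θ q : Fin 6 → ℝ) : ℂ := (1 / 6) * ∑ j, Complex.cosh (θ j + q j * Complex.I)

noncomputable def EE (θ : Fin 6 → ℝ) (d : Fin 6 → ℤ) (q : Fin 6 → ℝ) : ℂ :=
  ∏ j, Complex.exp ((θ j + q j * Complex.I) * d j)

lemma norm_EE (θ : Fin 6 → ℝ) (d : Fin 6 → ℤ) (q : Fin 6 → ℝ) :
    ‖EE θ d q‖ = Real.exp (∑ j, θ j * d j) := by
  unfold EE
  rw [norm_prod, Real.exp_sum]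
  apply Finset.prod_congr rfl
  intro j _
  rw [Complex.norm_exp]
  simp

lemma norm_cosh_le (t q : ℝ) :
    ‖Complex.cosh (t + q * Complex.I)‖ ≤ Real.cosh t - Real.sin q ^ 2 / (2 * Real.cosh t) := by
  have hc : 1 ≤ Real.cosh t := Real.one_le_cosh t
  have hs : Real.sin q ^ 2 ≤ 1 := Real.sin_sq_le_one q
  have hn : 0 ≤ Real.cosh t - Real.sin q ^ 2 / (2 * Real.cosh t) := by
    rw [sub_nonneg, div_le_iff₀ (by positivity)]
    nlinarith
  have e : ‖Complex.cosh (t + q * Complex.I)‖ ^ 2 = Real.cosh t ^ 2 - Real.sin q ^ 2 := by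
    rw [Complex.cosh_add, Complex.cosh_mul_I, Complex.sinh_mul_I, ← mul_assoc, ← Complex.ofReal_cosh, ← Complex.ofReal_sinh, ← Complex.ofReal_cos,
      ← Complex.ofReal_sin, ← Complex.ofReal_mul, ← Complex.ofReal_mul, Complex.sq_norm,
      Complex.normSq_add_mul_I]
    have := Real.sinh_sq t
    have := Real.sin_sq_add_cos_sq q
    have h3 : Real.cos q ^ 2 = 1 - Real.sin q ^ 2 := by linarith
    rw [mul_pow, mul_pow, h3, Real.sinh_sq]
    ring
  apply le_of_sq_le_sq _ hn
  rw [e]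
  have : (Real.cosh t - Real.sin q ^ 2 / (2 * Real.cosh t)) ^ 2
      = Real.cosh t ^ 2 - Real.sin q ^ 2 + (Real.sin q ^ 2 / (2 * Real.cosh t)) ^ 2 := by
    field_simp
    ring
  rw [this]
  nlinarith [sq_nonneg (Real.sin q ^ 2 / (2 * Real.cosh t))]

lemma norm_GG_le' (θ q : Fin 6 → ℝ) :
    ‖GG θ q‖ ≤ (∑ j, Real.cosh (θ j)) / 6 - (∑ j, Real.sin (q j) ^ 2 / (2 * Real.cosh (θ j))) / 6 := by
  unfold GG
  rw [norm_mul]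
  have h : ‖∑ j, Complex.cosh (θ j + q j * Complex.I)‖ ≤
      ∑ j, (Real.cosh (θ j) - Real.sin (q j) ^ 2 / (2 * Real.cosh (θ j))) :=
    (norm_sum_le _ _).trans (Finset.sum_le_sum fun j _ => norm_cosh_le _ _)
  rw [Finset.sum_sub_distrib] at h
  have : ‖(1 / 6 : ℂ)‖ = 1 / 6 := by norm_num
  rw [this]
  linarith

lemma norm_GG_le (θ q : Fin 6 → ℝ) : ‖GG θ q‖ ≤ (∑ j, Real.cosh (θ j)) / 6 := by
  have := norm_GG_le' θ q
  have h : 0 ≤ (∑ j, Real.sin (q j) ^ 2 / (2 * Real.cosh (θ j))) / 6 := by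
    have := fun j => Real.cosh_pos (θ j)
    apply div_nonneg _ (by norm_num)
    exact Finset.sum_nonneg fun j _ => div_nonneg (sq_nonneg _) (by linarith [this j])
  linarith

lemma S_pos (θ : Fin 6 → ℝ) : 0 < ∑ j, Real.cosh (θ j) :=
  Finset.sum_pos (fun j _ => Real.cosh_pos _) ⟨0, Finset.mem_univ _⟩

lemma norm_GG_pow_le (θ q : Fin 6 → ℝ) (n : ℕ) : ‖GG θ q‖ ^ n ≤ ((∑ j, Real.cosh (θ j)) / 6) ^ n *
    ∏ j, Real.exp (-(n / (2 * Real.cosh (θ j) * ∑ k, Real.cosh (θ k))) * Real.sin (q j) ^ 2) := by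
  have hS := S_pos θ
  set S := ∑ j, Real.cosh (θ j) with hSd
  set T := ∑ j, Real.sin (q j) ^ 2 / (2 * Real.cosh (θ j)) with hT
  have h1 : ‖GG θ q‖ ≤ S / 6 * Real.exp (-(T / S)) := by
    refine (norm_GG_le' θ q).trans ?_
    rw [← hSd, ← hT]
    have := Real.add_one_le_exp (-(T / S))
    calc S / 6 - T / 6 = S / 6 * (-(T / S) + 1) := by field_simp; ring
      _ ≤ _ := by gcongr
  calc ‖GG θ q‖ ^ n ≤ (S / 6 * Real.exp (-(T / S))) ^ n := by gcongr
    _ = _ := by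
      rw [mul_pow, ← Real.exp_nat_mul, ← Real.exp_sum]
      congr 2
      rw [hT, Finset.sum_div, ← Finset.sum_neg_distrib, Finset.mul_sum]
      apply Finset.sum_congr rfl
      intro j _
      have := Real.cosh_pos (θ j)
      field_simp

lemma cont_GG (θ : Fin 6 → ℝ) : Continuous (GG θ) := by
  unfold GG
  fun_prop

lemma cont_EE (θ : Fin 6 → ℝ) (d : Fin 6 → ℤ) : Continuous (EE θ d) := by
  unfold EE
  fun_prop

lemma integrable_GE (θ : Fin 6 → ℝ) (d : Fin 6 → ℤ) (n : ℕ) :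
    Integrable (fun q => GG θ q ^ n * EE θ d q) muB := by
  refine Integrable.of_bound
    (((cont_GG θ).pow n).mul (cont_EE θ d)).aestronglyMeasurable
    (((∑ j, Real.cosh (θ j)) / 6) ^ n * Real.exp (∑ j, θ j * d j)) (ae_of_all _ fun q => ?_)
  rw [norm_mul, norm_pow, norm_EE]
  gcongr
  exact norm_GG_le θ q

lemma int_one (t : ℝ) (m : ℤ) :
    ∫ x, Complex.exp ((t + x * Complex.I) * m) ∂muI = if m = 0 then (2 * π : ℂ) else 0 := by
  unfold muI
  rw [← intervalIntegral.integral_of_le (by linarith [pi_pos])]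
  split_ifs with h
  · subst h
    simp
    ring
  · have e : ∀ x : ℝ, Complex.exp ((t + x * Complex.I) * m)
        = Complex.exp (t * m) * Complex.exp ((m * Complex.I) * x) := by
      intro x
      rw [← Complex.exp_add]
      congr 1
      ring
    simp_rw [e]
    rw [intervalIntegral.integral_const_mul, integral_exp_mul_complex (by simp [h])]
    have : Complex.exp (m * Complex.I * (π : ℝ)) = Complex.exp (m * Complex.I * ((-π : ℝ) : ℂ)) := by
      rw [Complex.exp_eq_exp_iff_exists_int]
      refine ⟨m, ?_⟩
      push_cast
      ring
    rw [this]
    simp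

lemma EE_update (θ : Fin 6 → ℝ) (z w : Fin 6 → ℤ) (q : Fin 6 → ℝ) (j : Fin 6) (a : ℤ) :
    EE θ (Function.update z j (z j + a) - w) q
      = Complex.exp ((θ j + q j * Complex.I) * a) * EE θ (z - w) q := by
  unfold EE
  rw [← Finset.mul_prod_erase _ _ (Finset.mem_univ j), ← Finset.mul_prod_erase Finset.univ _ (Finset.mem_univ j),
    ← mul_assoc, ← Complex.exp_add]
  congr 1
  · congr 1
    simp
    ring
  · apply Finset.prod_congr rfl
    intro k hk
    have : k ≠ j := (Finset.mem_erase.1 hk).1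
    simp [Function.update_of_ne this]

lemma rw6_formula (θ : Fin 6 → ℝ) (n : ℕ) (z w : Fin 6 → ℤ) :
    (rw6 n z w : ℂ) * (2 * π) ^ 6 = ∫ q, GG θ q ^ n * EE θ (z - w) q ∂muB := by
  induction n generalizing z with
  | zero =>
    simp only [pow_zero, one_mul]
    unfold EE muB
    rw [integral_fintype_prod_eq_prod (f := fun j (x : ℝ) => Complex.exp ((θ j + x * Complex.I) * ((z - w) j : ℤ)))]
    simp_rw [int_one]
    by_cases h : z = w
    · subst h
      simp [rw6]
    · obtain ⟨j, hj⟩ := Function.ne_iff.1 h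
      rw [Finset.prod_eq_zero (Finset.mem_univ j)]
      · simp [rw6, h]
      · rw [if_neg]
        simpa [sub_eq_zero] using hj
  | succ n ih =>
    have e : ∀ q, GG θ q ^ (n + 1) * EE θ (z - w) q = (1 / 12) * ∑ j : Fin 6,
        (GG θ q ^ n * EE θ (Function.update z j (z j + 1) - w) q
          + GG θ q ^ n * EE θ (Function.update z j (z j - 1) - w) q) := by
      intro q
      have h1 : ∀ j, GG θ q ^ n * EE θ (Function.update z j (z j + 1) - w) q
          + GG θ q ^ n * EE θ (Function.update z j (z j - 1) - w) q
          = GG θ q ^ n * EE θ (z - w) q * 2 * Complex.cosh (θ j + q j * Complex.I) := by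
        intro j
        rw [sub_eq_add_neg (z j) 1, EE_update, EE_update, Complex.cosh]
        push_cast
        rw [mul_one, mul_neg_one]
        ring
      simp_rw [h1]
      rw [← Finset.mul_sum, pow_succ]
      nth_rewrite 2 [GG]
      ring
    simp_rw [e]
    rw [integral_const_mul, integral_finsetSum]
    · have : ∀ j : Fin 6, ∫ q, (GG θ q ^ n * EE θ (Function.update z j (z j + 1) - w) q
          + GG θ q ^ n * EE θ (Function.update z j (z j - 1) - w) q) ∂muB
          = (rw6 n (Function.update z j (z j + 1)) w : ℂ) * (2 * π) ^ 6
           + (rw6 n (Function.update z j (z j - 1)) w : ℂ) * (2 * π) ^ 6 := by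
        intro j
        rw [integral_add (integrable_GE _ _ _) (integrable_GE _ _ _), ih, ih]
      simp_rw [this, ← add_mul]
      rw [← Finset.sum_mul, rw6]
      push_cast
      ring
    · intro j _
      exact (integrable_GE _ _ _).add (integrable_GE _ _ _)

lemma int_sin (A : ℝ) (hA : 0 < A) :
    ∫ x, Real.exp (-A * Real.sin x ^ 2) ∂muI ≤ π * √(π / A) := by
  unfold muI
  rw [← intervalIntegral.integral_of_le (by linarith [pi_pos])]
  set f : ℝ → ℝ := fun x => Real.exp (-A * Real.sin x ^ 2) with hf
  have hc : Continuous f := by fun_prop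
  have hp : Function.Periodic f π := by
    intro x
    simp [hf, Real.sin_add_pi]
  have e1 := hp.intervalIntegral_add_eq (-π) (-(π / 2))
  have e2 := hp.intervalIntegral_add_eq 0 (-(π / 2))
  rw [neg_add_cancel] at e1
  rw [zero_add] at e2
  have e3 : -(π / 2) + π = π / 2 := by ring
  rw [e3] at e1 e2
  rw [← intervalIntegral.integral_add_adjacent_intervals (b := 0) (hc.intervalIntegrable _ _)
    (hc.intervalIntegrable _ _), e1, e2]
  set B : ℝ := 4 * A / π ^ 2 with hB
  have hBp : 0 < B := by have := pi_pos; positivity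
  have h1 : ∫ x in (-(π / 2))..(π / 2), f x ≤ ∫ x in (-(π / 2))..(π / 2), Real.exp (-B * x ^ 2) := by
    apply intervalIntegral.integral_mono_on (by linarith [pi_pos]) (hc.intervalIntegrable _ _)
    · exact Continuous.intervalIntegrable (by fun_prop) _ _
    · intro x hx
      have := mul_abs_le_abs_sin (abs_le.2 hx)
      have h2 : (2 / π * |x|) ^ 2 ≤ |sin x| ^ 2 := by
        have := pi_pos
        gcongr
      rw [sq_abs, mul_pow, sq_abs] at h2
      apply Real.exp_le_exp.2
      have : B * x ^ 2 = A * ((2 / π) ^ 2 * x ^ 2) := by rw [hB]; field_simp; ring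
      nlinarith
  have h2 : ∫ x in (-(π / 2))..(π / 2), Real.exp (-B * x ^ 2) ≤ √(π / B) := by
    rw [← integral_gaussian, intervalIntegral.integral_of_le (by linarith [pi_pos])]
    exact setIntegral_le_integral (integrable_exp_neg_mul_sq hBp)
      (ae_of_all _ fun x => (Real.exp_pos _).le)
  have h3 : √(π / B) = π / 2 * √(π / A) := by
    have := pi_pos
    have e : π / B = (π / 2) ^ 2 * (π / A) := by rw [hB]; field_simp; ring
    rw [e, Real.sqrt_mul (by positivity), Real.sqrt_sq (by positivity)]
  linarith

lemma chernoff (θ : Fin 6 → ℝ) (n : ℕ) (z w : Fin 6 → ℤ) :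
    rw6 n z w ≤ ((∑ j, Real.cosh (θ j)) / 6) ^ n * Real.exp (∑ j, θ j * ((z j - w j : ℤ) : ℝ)) := by
  have h := rw6_formula θ n z w
  set K := ((∑ j, Real.cosh (θ j)) / 6) ^ n * Real.exp (∑ j, θ j * ((z j - w j : ℤ) : ℝ)) with hK
  have h2 := norm_integral_le_of_norm_le_const (μ := muB) (C := K)
    (f := fun q => GG θ q ^ n * EE θ (z - w) q) (ae_of_all _ fun q => by
      rw [norm_mul, norm_pow, norm_EE, hK]
      simp only [Pi.sub_apply]
      gcongr
      exact norm_GG_le θ q)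
  have hm : muB.real Set.univ = (2 * π) ^ 6 := by
    have := pi_pos
    unfold muB muI Measure.real
    rw [Measure.pi_univ]
    simp [ENNReal.toReal_ofReal (show 0 ≤ π + π by positivity)]
    ring
  rw [← h, hm, norm_mul] at h2
  have hp : ‖((2 * π : ℂ)) ^ 6‖ = (2 * π) ^ 6 := by
    rw [norm_pow, norm_mul, Complex.norm_real, Real.norm_of_nonneg pi_pos.le]
    norm_num
  rw [hp, Complex.norm_real] at h2
  have := pi_pos
  exact (le_abs_self _).trans (le_of_mul_le_mul_right h2 (by positivity))

lemma gauss (θ : Fin 6 → ℝ) (n : ℕ) (hn : 1 ≤ n) (z w : Fin 6 → ℤ) :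
    rw6 n z w ≤ ((∑ j, Real.cosh (θ j)) / 6) ^ n * Real.exp (∑ j, θ j * ((z j - w j : ℤ) : ℝ)) *
      ((3 * π * ((∑ j, Real.cosh (θ j)) / 6) / n) ^ 3 * √(∏ j, Real.cosh (θ j))) := by
  have h := rw6_formula θ n z w
  set K := ((∑ j, Real.cosh (θ j)) / 6) ^ n * Real.exp (∑ j, θ j * ((z j - w j : ℤ) : ℝ)) with hK
  have hKp : 0 < K := by have := S_pos θ; positivity
  have hS := S_pos θ
  have hn' : (0 : ℝ) < n := by exact_mod_cast hn
  have := pi_pos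
  set S := ∑ j, Real.cosh (θ j) with hSd
  set A : Fin 6 → ℝ := fun j => n / (2 * Real.cosh (θ j) * S) with hA
  have hAp : ∀ j, 0 < A j := fun j => by have := Real.cosh_pos (θ j); simp only [hA]; positivity
  have hint1 : ∀ j, Integrable (fun x => Real.exp (-(A j) * Real.sin x ^ 2)) muI := by
    intro j
    refine Integrable.of_bound (Continuous.aestronglyMeasurable (by fun_prop)) 1 (ae_of_all _ fun x => ?_)
    rw [Real.norm_of_nonneg (Real.exp_pos _).le, Real.exp_le_one_iff]
    nlinarith [hAp j, sq_nonneg (Real.sin x), mul_nonneg (hAp j).le (sq_nonneg (Real.sin x))]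
  have hint : Integrable (fun q : Fin 6 → ℝ => K * ∏ j, Real.exp (-(A j) * Real.sin (q j) ^ 2)) muB :=
    (Integrable.fintype_prod (f := fun j x => Real.exp (-(A j) * Real.sin x ^ 2)) hint1).const_mul K
  have h2 := norm_integral_le_of_norm_le hint
    (f := fun q => GG θ q ^ n * EE θ (z - w) q) (ae_of_all _ fun q => by
      rw [norm_mul, norm_pow, norm_EE, hK]
      simp only [Pi.sub_apply]
      rw [mul_right_comm]
      gcongr
      exact norm_GG_pow_le θ q n)
  rw [integral_const_mul] at h2
  unfold muB at h2
  rw [integral_fintype_prod_eq_prod (f := fun j x => Real.exp (-(A j) * Real.sin x ^ 2))] at h2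
  change _ ≤ K * ∏ j, ∫ x, Real.exp (-(A j) * Real.sin x ^ 2) ∂muI at h2
  have h3 : ∏ j, ∫ x, Real.exp (-(A j) * Real.sin x ^ 2) ∂muI ≤ ∏ j, (π * √(π / A j)) := by
    apply Finset.prod_le_prod
    · intro j _
      exact integral_nonneg fun x => (Real.exp_pos _).le
    · intro j _
      exact int_sin _ (hAp j)
  have h4 : ∏ j, (π * √(π / A j)) = (2 * π) ^ 6 * ((3 * π * (S / 6) / n) ^ 3 * √(∏ j, Real.cosh (θ j))) := by
    have e : ∀ j, π / A j = (2 * π * S / n) * Real.cosh (θ j) := by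
      intro j
      have := Real.cosh_pos (θ j)
      simp only [hA]
      field_simp
    have hs : √(∏ j, Real.cosh (θ j)) = ∏ j, √(Real.cosh (θ j)) :=
      Real.sqrt_prod _ fun j _ => (Real.cosh_pos _).le
    have e2 : ∀ j, √(π / A j) = √(2 * π * S / n) * √(Real.cosh (θ j)) := by
      intro j
      rw [e, Real.sqrt_mul (by positivity)]
    simp_rw [e2]
    rw [hs, Finset.prod_mul_distrib, Finset.prod_mul_distrib, Finset.prod_const, Finset.prod_const]
    have e3 : √(2 * π * S / n) ^ 6 = (2 * π * S / n) ^ 3 := by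
      rw [show 6 = 2 * 3 by norm_num, pow_mul, Real.sq_sqrt (by positivity)]
    simp only [Finset.card_univ, Fintype.card_fin]
    rw [e3]
    ring
  change ‖∫ q, GG θ q ^ n * EE θ (z - w) q ∂muB‖ ≤ _ at h2
  rw [← h, norm_mul] at h2
  have hp : ‖((2 * π : ℂ)) ^ 6‖ = (2 * π) ^ 6 := by
    rw [norm_pow, norm_mul, Complex.norm_real, Real.norm_of_nonneg pi_pos.le]
    norm_num
  rw [hp, Complex.norm_real] at h2
  have h5 := h2.trans (mul_le_mul_of_nonneg_left (h3.trans h4.le) hKp.le)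
  have h6 : ‖rw6 n z w‖ ≤ K * ((3 * π * (S / 6) / n) ^ 3 * √(∏ j, Real.cosh (θ j))) := by
    apply le_of_mul_le_mul_right (a := (2 * π) ^ 6) _ (by positivity)
    linarith
  exact (le_abs_self _).trans h6

theorem rw6_gaussian_bound (b₀ : ℝ) (hb₀ : 0 < b₀)
    (hb : 6 * b₀ ^ 2 / (Real.sinh b₀) ^ 2 = b₀)
    (n : ℕ) (hn : 1 ≤ n) (z w : Fin 6 → ℤ) :
    rw6 n z w ≤ (3 * π / n) ^ 3 *
      Real.exp (-b₀ * (∑ j, ((z j - w j : ℤ) : ℝ) ^ 2) / (2 * n)) := by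
  have hb2 := aux_b b₀ hb₀ hb
  have hpi := Real.pi_gt_three
  have hn' : (0 : ℝ) < n := by exact_mod_cast hn
  set D : ℝ := ∑ j, ((z j - w j : ℤ) : ℝ) ^ 2 with hD
  have hD0 : 0 ≤ D := Finset.sum_nonneg fun j _ => sq_nonneg _
  set θ : Fin 6 → ℝ := fun j => -(2 / n) * ((z j - w j : ℤ) : ℝ) with hθ
  have t1 : ∑ j, θ j * ((z j - w j : ℤ) : ℝ) = -(2 / n) * D := by
    rw [hD, Finset.mul_sum]
    exact Finset.sum_congr rfl fun j _ => by simp only [hθ]; ring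
  have t2 : ∑ j, θ j ^ 2 = (2 / n) ^ 2 * D := by
    rw [hD, Finset.mul_sum]
    exact Finset.sum_congr rfl fun j _ => by simp only [hθ]; ring
  have hphi := aux_phi θ
  have hS := S_pos θ
  set φ := (∑ j, Real.cosh (θ j)) / 6 with hφ
  have hφ0 : 0 < φ := by positivity
  rw [t2] at hphi
  have hexp : Real.exp (-(D / n)) ≤ Real.exp (-b₀ * D / (2 * n)) := by
    apply Real.exp_le_exp.2
    have : -b₀ * D / (2 * n) = -((b₀ / 2) * (D / n)) := by field_simp
    rw [this]
    have : 0 ≤ D / n := by positivity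
    nlinarith
  have hpow : ∀ k : ℕ, φ ^ k ≤ Real.exp (k * ((2 / n) ^ 2 * D / 6)) := by
    intro k
    rw [Real.exp_nat_mul]
    gcongr
  refine le_trans ?_ (mul_le_mul_of_nonneg_left hexp (by positivity))
  rcases Nat.lt_or_ge n 10 with h9 | h9
  · have h := chernoff θ n z w
    rw [t1, ← hφ] at h
    have hle : (1 : ℝ) ≤ (3 * π / n) ^ 3 := by
      apply one_le_pow₀
      rw [le_div_iff₀ hn']
      have : (n : ℝ) ≤ 9 := by exact_mod_cast Nat.lt_succ_iff.1 h9
      linarith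
    calc rw6 n z w ≤ φ ^ n * Real.exp (-(2 / n) * D) := h
      _ ≤ Real.exp (n * ((2 / n) ^ 2 * D / 6)) * Real.exp (-(2 / n) * D) := by
        gcongr
        exact hpow n
      _ ≤ 1 * Real.exp (-(D / n)) := by
        rw [← Real.exp_add, one_mul]
        apply Real.exp_le_exp.2
        have : n * ((2 / n) ^ 2 * D / 6) + -(2 / n) * D = -(4 / 3) * (D / n) := by
          field_simp; ring
        rw [this]
        have : 0 ≤ D / n := by positivity
        linarith
      _ ≤ _ := by gcongr
  · have h := gauss θ n hn z w
    rw [t1, ← hφ] at h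
    have hsq : √(∏ j, Real.cosh (θ j)) ≤ Real.exp ((2 / n) ^ 2 * D / 4) := by
      apply Real.sqrt_le_iff.2 ⟨(Real.exp_pos _).le, ?_⟩
      rw [← Real.exp_nat_mul]
      calc ∏ j, Real.cosh (θ j) ≤ ∏ j, Real.exp (θ j ^ 2 / 2) :=
            Finset.prod_le_prod (fun j _ => (Real.cosh_pos _).le) fun j _ => Real.cosh_le_exp_half_sq _
        _ = _ := by
          rw [← Real.exp_sum, ← Finset.sum_div, t2]
          congr 1
          push_cast
          ring
    calc rw6 n z w ≤ _ := h
      _ = (3 * π / n) ^ 3 * (φ ^ (n + 3) * Real.exp (-(2 / n) * D) * √(∏ j, Real.cosh (θ j))) := by ring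
      _ ≤ (3 * π / n) ^ 3 * (Real.exp ((n + 3 : ℕ) * ((2 / n) ^ 2 * D / 6)) * Real.exp (-(2 / n) * D)
            * Real.exp ((2 / n) ^ 2 * D / 4)) := by
        gcongr
        exact hpow (n + 3)
      _ ≤ _ := by
        rw [← Real.exp_add, ← Real.exp_add]
        gcongr
        have e : ((n + 3 : ℕ) : ℝ) * ((2 / n) ^ 2 * D / 6) + -(2 / n) * D + (2 / n) ^ 2 * D / 4
            = -(4 / 3) * (D / n) + 3 * (D / n) * (1 / n) := by
          push_cast
          field_simp
          ring
        rw [e]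
        have h0 : 0 ≤ D / n := by positivity
        have h10 : (1 : ℝ) / n ≤ 1 / 9 := by
          apply one_div_le_one_div_of_le (by norm_num)
          have : (10 : ℝ) ≤ n := by exact_mod_cast h9
          linarith
        nlinarith
end

section
/- The Green's function of the lattice Laplacian on ℤ³ at the origin equals (-Δ_{ℤ³})^{-1}(0,0) = ((√3-1)/(192π³)) Γ(1/24)² Γ(11/24)², the Watson integral; moreover for a nearest neighbor e of 0, (-Δ_{ℤ³})^{-1}(0,e) = (-Δ_{ℤ³})^{-1}(0,0) - 1/6. -/
open Real MeasureTheory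

/-- The dispersion relation of the lattice Laplacian on `ℤ³`. -/
noncomputable def eps3 (p : Fin 3 → ℝ) : ℝ := ∑ j, 2 * (1 - Real.cos (p j))

/-- The Green's function `(-Δ_{ℤ³})⁻¹(0,x)` of the lattice Laplacian on `ℤ³`,
via its Fourier representation. -/
noncomputable def green3zero (x : Fin 3 → ℤ) : ℝ :=
  (1 / (2 * π) ^ 3) *
    ∫ p in Set.univ.pi fun _ : Fin 3 => Set.Icc (-π) π,
      Real.cos (∑ j, p j * (x j : ℝ)) / eps3 p


lemma hasSum_congr' {f g : ℕ → ℝ} {a b : ℝ} (h : HasSum f a) (hf : ∀ n, g n = f n) (hb : b = a) :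
    HasSum g b := by
  have : g = f := funext hf
  rw [this, hb]; exact h

lemma real_hasSum_exp (x : ℝ) : HasSum (fun n : ℕ => x ^ n / n.factorial) (exp x) := by
  rw [Real.exp_eq_exp_ℝ]
  exact NormedSpace.expSeries_div_hasSum_exp x

lemma subst_lint {g g' : ℝ → ℝ} {s t : Set ℝ} (hs : MeasurableSet s)
    (hd : ∀ x ∈ s, HasDerivAt g (g' x) x) (hb : Set.BijOn g s t)
    {F f : ℝ → ENNReal} (h : ∀ x ∈ s, ENNReal.ofReal |g' x| * F (g x) = f x) :
    ∫⁻ y in t, F y = ∫⁻ x in s, f x := by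
  rw [← hb.image_eq, lintegral_image_eq_lintegral_abs_deriv_mul hs
    (fun x hx => (hd x hx).hasDerivWithinAt) hb.injOn]
  exact setLIntegral_congr_fun hs h

lemma gamma_lint {s r : ℝ} (hs : 0 < s) (hr : 0 < r) :
    ∫⁻ t in Set.Ioi (0:ℝ), ENNReal.ofReal (t ^ (s - 1) * exp (-(r * t)))
      = ENNReal.ofReal ((1 / r) ^ s * Gamma s) := by
  rw [← integral_rpow_mul_exp_neg_mul_Ioi hs hr, ofReal_integral_eq_lintegral_ofReal]
  · have h := integral_rpow_mul_exp_neg_mul_Ioi hs hr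
    by_contra hc
    rw [integral_undef hc] at h
    have : 0 < (1 / r) ^ s * Gamma s := by
      have := Gamma_pos_of_pos hs
      positivity
    linarith
  · filter_upwards [ae_restrict_mem measurableSet_Ioi] with t ht
    have : (0:ℝ) < t := ht
    positivity

lemma beta_lint {a b : ℝ} (ha : 0 < a) (hb : 0 < b) :
    ∫⁻ x in Set.Ioo (0:ℝ) 1, ENNReal.ofReal (x ^ (a - 1) * (1 - x) ^ (b - 1))
      = ENNReal.ofReal (Gamma a * Gamma b / Gamma (a + b)) := by
  have h := ProbabilityTheory.lintegral_betaPDF_eq_one ha hb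
  have hB := ProbabilityTheory.beta_pos ha hb
  rw [ProbabilityTheory.lintegral_betaPDF] at h
  have h2 : ∀ x ∈ Set.Ioo (0:ℝ) 1, ENNReal.ofReal (x ^ (a - 1) * (1 - x) ^ (b - 1))
      = ENNReal.ofReal (ProbabilityTheory.beta a b) *
        ENNReal.ofReal (1 / ProbabilityTheory.beta a b * x ^ (a - 1) * (1 - x) ^ (b - 1)) := by
    intro x hx
    rw [← ENNReal.ofReal_mul hB.le]
    congr 1
    field_simp
  rw [setLIntegral_congr_fun measurableSet_Ioo h2, lintegral_const_mul' _ _ ENNReal.ofReal_ne_top,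
    h, mul_one]
  rfl

/-- termwise integration of a nonnegative series -/
lemma lint_hasSum {s : Set ℝ} (hs : MeasurableSet s) {f : ℕ → ℝ → ℝ} {g : ℝ → ℝ}
    (hm : ∀ n, Measurable (f n)) (h0 : ∀ n, ∀ x ∈ s, 0 ≤ f n x)
    (hg : ∀ x ∈ s, HasSum (fun n => f n x) (g x)) :
    ∫⁻ x in s, ENNReal.ofReal (g x) = ∑' n, ∫⁻ x in s, ENNReal.ofReal (f n x) := by
  rw [← lintegral_tsum (fun n => ((hm n).ennreal_ofReal).aemeasurable)]
  refine setLIntegral_congr_fun hs (fun x hx => ?_)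
  show ENNReal.ofReal (g x) = _
  rw [← (hg x hx).tsum_eq, ENNReal.ofReal_tsum_of_nonneg (fun n => h0 n x hx) (hg x hx).summable]

/-- constant factor -/
lemma lint_const_mul {s : Set ℝ} {f : ℝ → ℝ} {c : ℝ} (hc : 0 ≤ c) :
    ∫⁻ x in s, ENNReal.ofReal (c * f x) = ENNReal.ofReal c * ∫⁻ x in s, ENNReal.ofReal (f x) := by
  rw [← lintegral_const_mul' _ _ ENNReal.ofReal_ne_top]
  refine lintegral_congr (fun x => ?_)
  rw [ENNReal.ofReal_mul hc]

/-- conversion of an `ENNReal` series to a real `HasSum` -/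
lemma hasSum_of_ennreal {f : ℕ → ℝ} {a : ℝ} (h0 : ∀ n, 0 ≤ f n) (ha : 0 ≤ a)
    (h : ∑' n, ENNReal.ofReal (f n) = ENNReal.ofReal a) : HasSum f a := by
  have hs : Summable f := by
    have : ∑' n, ENNReal.ofReal (f n) ≠ ⊤ := by rw [h]; exact ENNReal.ofReal_ne_top
    have h2 := ENNReal.summable_toReal this
    refine h2.congr (fun n => ENNReal.toReal_ofReal (h0 n))
  rw [← ENNReal.ofReal_tsum_of_nonneg h0 hs] at h
  have := (ENNReal.ofReal_eq_ofReal_iff (tsum_nonneg h0) ha).1 h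
  rw [← this]
  exact hs.hasSum

lemma gamma_term {s : ℝ} (hs : 0 < s) (n : ℕ) {x : ℝ} :
    ∀ t ∈ Set.Ioi (0:ℝ), x ^ n / n.factorial * (t ^ (s + n - 1) * exp (-(1 * t)))
     = t ^ (s - 1) * exp (-(1 * t)) * ((t * x) ^ n / n.factorial) := by
  intro t ht
  have ht : (0:ℝ) < t := ht
  have : t ^ (s + n - 1) = t ^ (s - 1) * t ^ n := by
    rw [← rpow_natCast t n, ← rpow_add ht]; ring_nf
  rw [this, mul_pow]; ring

lemma binom_hasSum {s x : ℝ} (hs : 0 < s) (hx0 : 0 ≤ x) (hx1 : x < 1) :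
    HasSum (fun n : ℕ => Gamma (s + n) / n.factorial * x ^ n) (Gamma s * (1 - x) ^ (-s)) := by
  have hG : ∀ n : ℕ, 0 < Gamma (s + n) := fun n => Gamma_pos_of_pos (by positivity)
  refine hasSum_of_ennreal (fun n => by have := hG n; positivity) ?_ ?_
  · have := Gamma_pos_of_pos hs
    have : 0 < 1 - x := by linarith
    positivity
  have key := lint_hasSum (s := Set.Ioi (0:ℝ)) measurableSet_Ioi
    (f := fun n t => t ^ (s - 1) * exp (-(1 * t)) * ((t * x) ^ n / n.factorial))
    (g := fun t => t ^ (s - 1) * exp (-((1 - x) * t)))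
    (fun n => by fun_prop) (fun n t ht => by
      have : (0:ℝ) < t := ht
      positivity) (fun t ht => by
      have h := (real_hasSum_exp (t * x)).mul_left (t ^ (s - 1) * exp (-(1 * t)))
      refine hasSum_congr' h (fun n => rfl) ?_
      rw [mul_assoc, ← Real.exp_add]; ring_nf)
  rw [gamma_lint hs (by linarith : 0 < 1 - x)] at key
  have e1 : (1 / (1 - x)) ^ s * Gamma s = Gamma s * (1 - x) ^ (-s) := by
    rw [one_div, inv_rpow (by linarith), rpow_neg (by linarith)]; ring
  rw [← e1, key]
  refine tsum_congr (fun n => ?_)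
  rw [← setLIntegral_congr_fun measurableSet_Ioi (fun t ht => congrArg ENNReal.ofReal
    (gamma_term hs n (x := x) t ht)), lint_const_mul (by positivity), gamma_lint (by positivity) one_pos,
    ← ENNReal.ofReal_mul (by positivity)]
  congr 1
  simp; ring

/-- even part -/
lemma binom_even_hasSum {s x : ℝ} (hs : 0 < s) (hx0 : 0 ≤ x) (hx1 : x < 1) :
    HasSum (fun n : ℕ => 2 * (Gamma (s + (2 * n : ℕ)) / (2 * n).factorial * x ^ (2 * n)))
      (Gamma s * (1 - x) ^ (-s) + Gamma s * (1 + x) ^ (-s)) := by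
  have hG : ∀ n : ℕ, 0 < Gamma (s + n) := fun n => Gamma_pos_of_pos (by positivity)
  have hGs := Gamma_pos_of_pos hs
  have hx2 : 0 < 1 - x := by linarith
  have hx3 : 0 < 1 + x := by linarith
  refine hasSum_of_ennreal (fun n => by have := hG (2 * n); positivity) ?_ ?_
  · positivity
  have key := lint_hasSum (s := Set.Ioi (0:ℝ)) measurableSet_Ioi
    (f := fun n t => 2 * (t ^ (s - 1) * exp (-(1 * t)) * ((t * x) ^ (2 * n) / (2 * n).factorial)))
    (g := fun t => t ^ (s - 1) * exp (-((1 - x) * t)) + t ^ (s - 1) * exp (-((1 + x) * t)))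
    (fun n => by fun_prop) (fun n t ht => by
      have : (0:ℝ) < t := ht
      positivity) (fun t ht => by
      have h := ((Real.hasSum_cosh (t * x)).mul_left (t ^ (s - 1) * exp (-(1 * t)))).mul_left 2
      refine hasSum_congr' h (fun n => rfl) ?_
      rw [Real.cosh_eq]
      have : exp (-((1 - x) * t)) = exp (-(1 * t)) * exp (t * x) := by
        rw [← Real.exp_add]; ring_nf
      have h2 : exp (-((1 + x) * t)) = exp (-(1 * t)) * exp (-(t * x)) := by
        rw [← Real.exp_add]; ring_nf
      rw [this, h2]; ring)
  have e1 : (1 / (1 - x)) ^ s * Gamma s = Gamma s * (1 - x) ^ (-s) := by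
    rw [one_div, inv_rpow (by linarith), rpow_neg (by linarith)]; ring
  have e2 : (1 / (1 + x)) ^ s * Gamma s = Gamma s * (1 + x) ^ (-s) := by
    rw [one_div, inv_rpow (by linarith), rpow_neg (by linarith)]; ring
  rw [setLIntegral_congr_fun measurableSet_Ioi (g := fun t =>
    ENNReal.ofReal (t ^ (s - 1) * exp (-((1 - x) * t))) +
    ENNReal.ofReal (t ^ (s - 1) * exp (-((1 + x) * t)))) (fun t ht => by
      have : (0:ℝ) < t := ht
      exact ENNReal.ofReal_add (by positivity) (by positivity)),
    lintegral_add_left (by fun_prop), gamma_lint hs hx2, gamma_lint hs hx3, e1, e2,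
    ← ENNReal.ofReal_add (by positivity) (by positivity)] at key
  rw [key]
  refine tsum_congr (fun n => ?_)
  rw [lint_const_mul (by norm_num), ← setLIntegral_congr_fun measurableSet_Ioi (fun t ht => congrArg ENNReal.ofReal
    (gamma_term hs (2 * n) (x := x) t ht)), lint_const_mul (by positivity), gamma_lint (by positivity) one_pos,
    ← ENNReal.ofReal_mul (by positivity), ← ENNReal.ofReal_mul (by positivity)]
  congr 1
  simp; ring

/-- Gauss' summation -/
lemma gauss_sum {a b c : ℝ} (ha : 0 < a) (hb : 0 < b) (hc : a + b < c) :
    ∑' n : ℕ, ENNReal.ofReal (Gamma (a + n) * Gamma (b + n) / (n.factorial * Gamma (c + n)))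
      = ENNReal.ofReal (Gamma a * Gamma b * Gamma (c - a - b) / (Gamma (c - a) * Gamma (c - b))) := by
  have hcb : 0 < c - b := by linarith
  have hG := Gamma_pos_of_pos hcb
  have key := lint_hasSum (s := Set.Ioo (0:ℝ) 1) measurableSet_Ioo
    (f := fun n t => Gamma (a + n) / n.factorial * (t ^ (b + n - 1) * (1 - t) ^ (c - b - 1)))
    (g := fun t => Gamma a * (t ^ (b - 1) * (1 - t) ^ (c - a - b - 1)))
    (fun n => by fun_prop) (fun n t ht => by
      have h1 : (0:ℝ) < t := ht.1
      have h2 : 0 < 1 - t := by linarith [ht.2]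
      have : 0 < Gamma (a + n) := Gamma_pos_of_pos (by positivity)
      positivity) (fun t ht => by
      have h1 : (0:ℝ) < t := ht.1
      have h2 : 0 < 1 - t := by linarith [ht.2]
      have h := (binom_hasSum ha h1.le ht.2).mul_right (t ^ (b - 1) * (1 - t) ^ (c - b - 1))
      refine hasSum_congr' h (fun n => ?_) ?_
      · have : t ^ (b + n - 1) = t ^ (b - 1) * t ^ n := by
          rw [← rpow_natCast t n, ← rpow_add h1]; ring_nf
        rw [this]; ring
      · have : (1 - t) ^ (c - a - b - 1) = (1 - t) ^ (-a) * (1 - t) ^ (c - b - 1) := by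
          rw [← rpow_add h2]; ring_nf
        rw [this]; ring)
  rw [lint_const_mul (Gamma_pos_of_pos ha).le, beta_lint hb (by linarith)] at key
  have h2 : ∀ n : ℕ, ENNReal.ofReal (Gamma (a + n) * Gamma (b + n) / (n.factorial * Gamma (c + n)))
     = ENNReal.ofReal (1 / Gamma (c - b)) * ∫⁻ t in Set.Ioo (0:ℝ) 1, ENNReal.ofReal
       (Gamma (a + n) / n.factorial * (t ^ (b + n - 1) * (1 - t) ^ (c - b - 1))) := by
    intro n
    have h1 : 0 < Gamma (a + n) := Gamma_pos_of_pos (by positivity)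
    have h3 : 0 < Gamma (c + n) := Gamma_pos_of_pos (by linarith [(Nat.cast_nonneg n : (0:ℝ) ≤ n)])
    rw [lint_const_mul (by positivity), beta_lint (by positivity) hcb,
      ← ENNReal.ofReal_mul (by positivity), ← ENNReal.ofReal_mul (by positivity)]
    congr 1
    rw [show b + n + (c - b) = c + n by ring]
    field_simp
  simp_rw [h2]
  rw [ENNReal.tsum_mul_left, ← key, ← ENNReal.ofReal_mul (Gamma_pos_of_pos ha).le,
    ← ENNReal.ofReal_mul (by positivity)]
  congr 1
  rw [show b + (c - a - b) = c - a by ring]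
  field_simp


lemma beta_inf {a b : ℝ} (ha : 0 < a) (hb : 0 < b) :
    ∫⁻ w in Set.Ioi (0:ℝ), ENNReal.ofReal (w ^ (a - 1) * (1 + w) ^ (-(a + b)))
      = ENNReal.ofReal (Gamma a * Gamma b / Gamma (a + b)) := by
  rw [← beta_lint ha hb]
  symm
  refine subst_lint (g := fun w => w / (1 + w)) (g' := fun w => 1 / (1 + w) ^ 2)
    measurableSet_Ioi ?_ ?_ ?_
  · intro w hw
    have hw : (0:ℝ) < w := hw
    have := (hasDerivAt_id w).div ((hasDerivAt_id w).const_add 1) (by simp; positivity)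
    refine this.congr_deriv ?_
    simp
  · refine Set.InvOn.bijOn (f' := fun x => x / (1 - x)) ⟨?_, ?_⟩ ?_ ?_
    · intro w hw
      have hw : (0:ℝ) < w := hw
      simp only
      have h : 1 - w / (1 + w) = 1 / (1 + w) := by field_simp; ring
      rw [h]; field_simp
    · intro x hx
      have : 0 < 1 - x := by linarith [hx.2]
      simp only
      have h : 1 + x / (1 - x) = 1 / (1 - x) := by field_simp; ring
      rw [h]; field_simp
    · intro w hw
      have hw : (0:ℝ) < w := hw
      refine ⟨by positivity, ?_⟩
      simp only
      rw [div_lt_one (by positivity)]; linarith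
    · intro x hx
      have : 0 < 1 - x := by linarith [hx.2]
      exact div_pos hx.1 this
  · intro w hw
    have hw : (0:ℝ) < w := hw
    have hw1 : (0:ℝ) < 1 + w := by linarith
    rw [← ENNReal.ofReal_mul (abs_nonneg _), abs_of_pos (by positivity)]
    congr 1
    have h : 1 - w / (1 + w) = (1 + w)⁻¹ := by field_simp; ring
    have h2 : (1 + w) ^ (-(a + b)) = ((1 + w) ^ (a - 1))⁻¹ * ((1 + w) ^ (b - 1))⁻¹ * ((1 + w) ^ 2)⁻¹ := by
      rw [← rpow_neg hw1.le, ← rpow_neg hw1.le, ← rpow_natCast (1 + w) 2, ← rpow_neg hw1.le,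
        ← rpow_add hw1, ← rpow_add hw1]
      congr 1; push_cast; ring
    rw [h, div_rpow hw.le hw1.le, inv_rpow hw1.le, h2]
    ring

lemma beta_inf2 {a b : ℝ} (ha : 0 < a) (hb : 0 < b) :
    ∫⁻ w in Set.Ioi (0:ℝ), ENNReal.ofReal (w ^ (a - 1) * (1 + w ^ 2) ^ (-((a + b) / 2)))
      = ENNReal.ofReal (1 / 2 * (Gamma (a / 2) * Gamma (b / 2) / Gamma ((a + b) / 2))) := by
  have h0 := beta_inf (half_pos ha) (half_pos hb)
  rw [subst_lint (F := fun w => ENNReal.ofReal (w ^ (a / 2 - 1) * (1 + w) ^ (-(a / 2 + b / 2))))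
    (t := Set.Ioi (0:ℝ)) (f := fun w => ENNReal.ofReal (2 * (w ^ (a - 1) * (1 + w ^ 2) ^ (-((a + b) / 2)))))
    (s := Set.Ioi (0:ℝ)) (g := fun w => w ^ 2) (g' := fun w => 2 * w) measurableSet_Ioi,
    lint_const_mul (by norm_num)] at h0
  · rw [ENNReal.ofReal_mul (by norm_num), show (a + b) / 2 = a / 2 + b / 2 by ring, ← h0,
      ← mul_assoc, ← ENNReal.ofReal_mul (by norm_num)]
    norm_num
    congr! 5
    ring
  · intro w _
    simpa using hasDerivAt_pow 2 w
  · refine Set.InvOn.bijOn (f' := fun x => √x) ⟨?_, ?_⟩ ?_ ?_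
    · intro w hw
      exact Real.sqrt_sq (le_of_lt hw)
    · intro w hw
      exact Real.sq_sqrt (le_of_lt hw)
    · intro w hw
      have hw : (0:ℝ) < w := hw
      show 0 < w ^ 2
      positivity
    · intro w hw
      exact Real.sqrt_pos.2 hw
  · intro w hw
    have hw : (0:ℝ) < w := hw
    rw [← ENNReal.ofReal_mul (abs_nonneg _), abs_of_pos (by positivity)]
    congr 1
    have : (w ^ 2) ^ (a / 2 - 1) * w = w ^ (a - 1) := by
      rw [← rpow_natCast w 2, ← rpow_mul hw.le, ← rpow_add_one hw.ne']
      congr 1; push_cast; ring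
    rw [← this, show (a + b) / 2 = a / 2 + b / 2 by ring]
    ring

lemma beta_sq {a b : ℝ} (ha : 0 < a) (hb : 0 < b) :
    ∫⁻ w in Set.Ioo (0:ℝ) 1, ENNReal.ofReal (w ^ (2 * a - 1) * (1 - w ^ 2) ^ (b - 1))
      = ENNReal.ofReal (1 / 2 * (Gamma a * Gamma b / Gamma (a + b))) := by
  have h0 := beta_lint ha hb
  rw [subst_lint (F := fun w => ENNReal.ofReal (w ^ (a - 1) * (1 - w) ^ (b - 1)))
    (t := Set.Ioo (0:ℝ) 1) (f := fun w => ENNReal.ofReal (2 * (w ^ (2 * a - 1) * (1 - w ^ 2) ^ (b - 1))))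
    (s := Set.Ioo (0:ℝ) 1) (g := fun w => w ^ 2) (g' := fun w => 2 * w) measurableSet_Ioo,
    lint_const_mul (by norm_num)] at h0
  · rw [ENNReal.ofReal_mul (by norm_num), ← h0,
      ← mul_assoc, ← ENNReal.ofReal_mul (by norm_num)]
    norm_num
  · intro w _
    simpa using hasDerivAt_pow 2 w
  · refine Set.InvOn.bijOn (f' := fun x => √x) ⟨?_, ?_⟩ ?_ ?_
    · intro w hw
      exact Real.sqrt_sq (le_of_lt hw.1)
    · intro w hw
      exact Real.sq_sqrt (le_of_lt hw.1)
    · intro w hw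
      have := hw.1
      have := hw.2
      refine ⟨by positivity, ?_⟩
      show w ^ 2 < 1
      nlinarith
    · intro w hw
      refine ⟨Real.sqrt_pos.2 hw.1, ?_⟩
      rw [Real.sqrt_lt' one_pos]; simpa using hw.2
  · intro w hw
    have hw : (0:ℝ) < w := hw.1
    rw [← ENNReal.ofReal_mul (abs_nonneg _), abs_of_pos (by positivity)]
    congr 1
    have : (w ^ 2) ^ (a - 1) * w = w ^ (2 * a - 1) := by
      rw [← rpow_natCast w 2, ← rpow_mul hw.le, ← rpow_add_one hw.ne']
      congr 1; push_cast; ring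
    rw [← this]
    ring

noncomputable def PhiW (a b z : ℝ) : ENNReal :=
  ∫⁻ w in Set.Ioi (0:ℝ), ENNReal.ofReal (w ^ (a - 1) * (1 + w ^ 2 - 2 * z * w) ^ (-((a + b) / 2)))

lemma rpow_shift {w : ℝ} (hw : 0 < w) (a : ℝ) (n : ℕ) : w ^ (a + n - 1) = w ^ (a - 1) * w ^ n := by
  rw [← rpow_natCast w n, ← rpow_add hw]; ring_nf

lemma phi_a {a b t : ℝ} (ha : 0 < a) (hb : 0 < b) (ht0 : 0 < t) (ht1 : t < 1) :
    PhiW a b (2 * t - 1) = ∑' n : ℕ, ENNReal.ofReal (√π * 2 ^ (1 - (a + b)) / Gamma ((a + b) / 2) *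
      (Gamma (a + n) * Gamma (b + n) / (n.factorial * Gamma ((a + b + 1) / 2 + n)) * t ^ n)) := by
  set s := (a + b) / 2 with hs
  have hs0 : 0 < s := by positivity
  have hGs := Gamma_pos_of_pos hs0
  have hG : ∀ n : ℕ, 0 < Gamma (s + n) := fun n => Gamma_pos_of_pos (by positivity)
  have key := lint_hasSum (s := Set.Ioi (0:ℝ)) measurableSet_Ioi
    (f := fun n w => Gamma (s + n) / (Gamma s * n.factorial) * (4 * t) ^ n *
      (w ^ (a + n - 1) * (1 + w) ^ (-((a + n) + (b + n)))))
    (g := fun w => w ^ (a - 1) * (1 + w ^ 2 - 2 * (2 * t - 1) * w) ^ (-s))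
    (fun n => by fun_prop) (fun n w hw => by
      have : (0:ℝ) < w := hw
      have := hG n
      positivity) (fun w hw => by
      have hw : (0:ℝ) < w := hw
      have hw1 : (0:ℝ) < 1 + w := by linarith
      have hx1 : 4 * t * w / (1 + w) ^ 2 < 1 := by
        rw [div_lt_one (by positivity)]
        nlinarith [sq_nonneg (1 - w), mul_pos hw (sub_pos.2 ht1)]
      have h := (binom_hasSum hs0 (x := 4 * t * w / (1 + w) ^ 2) (by positivity) hx1).mul_left
        (w ^ (a - 1) * (1 + w) ^ (-(2 * s)) / Gamma s)
      refine hasSum_congr' h (fun n => ?_) ?_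
      · rw [rpow_shift hw]
        have : (1 + w) ^ (-((a + n) + (b + n))) = (1 + w) ^ (-(2 * s)) * (((1 + w) ^ 2) ^ n)⁻¹ := by
          rw [← pow_mul, ← rpow_natCast (1 + w) (2 * n), ← rpow_neg hw1.le, ← rpow_add hw1]
          congr 1; push_cast; rw [hs]; ring
        rw [this, div_pow, mul_pow (4 * t)]
        field_simp
      · have e : 1 + w ^ 2 - 2 * (2 * t - 1) * w = (1 + w) ^ 2 * (1 - 4 * t * w / (1 + w) ^ 2) := by
          field_simp; ring
        rw [e, mul_rpow (by positivity) (by linarith), ← rpow_natCast (1 + w) 2, ← rpow_mul hw1.le]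
        rw [show ((2:ℕ):ℝ) * -s = -(2 * s) by push_cast; ring]
        field_simp)
  rw [PhiW, key]
  refine tsum_congr (fun n => ?_)
  have := hG n
  have hGa : 0 < Gamma (a + n) := Gamma_pos_of_pos (by positivity)
  have hGb : 0 < Gamma (b + n) := Gamma_pos_of_pos (by positivity)
  rw [lint_const_mul (by positivity), beta_inf (by positivity) (by positivity),
    ← ENNReal.ofReal_mul (by positivity)]
  congr 1
  have hd := Real.Gamma_mul_Gamma_add_half (s + n)
  rw [show s + n + 1 / 2 = (a + b + 1) / 2 + n by rw [hs]; ring,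
    show 2 * (s + n) = a + n + (b + n) by rw [hs]; ring] at hd
  have h1 : 0 < Gamma ((a + b + 1) / 2 + n) := Gamma_pos_of_pos (by positivity)
  have h2 : 0 < Gamma (a + n + (b + n)) := Gamma_pos_of_pos (by positivity)
  have h3 : (2:ℝ) ^ (1 - (a + n + (b + n))) * 4 ^ n = 2 ^ (1 - (a + b)) := by
    rw [show (4:ℝ) = 2 ^ 2 by norm_num, ← pow_mul, ← rpow_natCast 2 (2 * n), ← rpow_add two_pos]
    congr 1; push_cast; ring
  rw [← h3]
  have h4 : Gamma (s + n) = Gamma (a + n + (b + n)) * 2 ^ (1 - (a + n + (b + n))) * √π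
      / Gamma ((a + b + 1) / 2 + n) := by
    rw [eq_div_iff h1.ne', hd]
  rw [h4, mul_pow]
  field_simp

/-- common integrated term for `phi_b`, `phi_c` -/
lemma phi_b_term {a b z : ℝ} (ha : 0 < a) (hb : 0 < b) (hz : 0 ≤ z) (n : ℕ) :
    ∫⁻ w in Set.Ioi (0:ℝ), ENNReal.ofReal (Gamma ((a + b) / 2 + n) /
      (Gamma ((a + b) / 2) * n.factorial) * (2 * z) ^ n *
      (w ^ (a + n - 1) * (1 + w ^ 2) ^ (-(((a + n) + (b + n)) / 2)))) =
    ENNReal.ofReal ((2 * z) ^ n / (n.factorial * Gamma ((a + b) / 2)) *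
      (1 / 2 * (Gamma ((a + n) / 2) * Gamma ((b + n) / 2)))) := by
  have h0 : 0 < Gamma ((a + b) / 2) := Gamma_pos_of_pos (by positivity)
  have hG : 0 < Gamma ((a + b) / 2 + n) := Gamma_pos_of_pos (by positivity)
  rw [lint_const_mul (by positivity), beta_inf2 (by positivity) (by positivity),
    ← ENNReal.ofReal_mul (by positivity), show (a + n + (b + n)) / 2 = (a + b) / 2 + n by ring]
  congr 1
  field_simp

lemma phi_b_alg {a b z w : ℝ} (ha : 0 < a) (hb : 0 < b) (hw : 0 < w) (n : ℕ) :
    Gamma ((a + b) / 2 + n) /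
      (Gamma ((a + b) / 2) * n.factorial) * (2 * z) ^ n *
      (w ^ (a + n - 1) * (1 + w ^ 2) ^ (-(((a + n) + (b + n)) / 2)))
    = (w ^ (a - 1) * (1 + w ^ 2) ^ (-((a + b) / 2)) / Gamma ((a + b) / 2)) *
      (Gamma ((a + b) / 2 + n) / n.factorial * (2 * z * w / (1 + w ^ 2)) ^ n) := by
  have h0 : 0 < Gamma ((a + b) / 2) := Gamma_pos_of_pos (by positivity)
  have hw1 : 0 < 1 + w ^ 2 := by positivity
  rw [rpow_shift hw]
  have : (1 + w ^ 2) ^ (-(((a + n) + (b + n)) / 2)) = (1 + w ^ 2) ^ (-((a + b) / 2)) * ((1 + w ^ 2) ^ n)⁻¹ := by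
    rw [← rpow_natCast (1 + w ^ 2) n, ← rpow_neg hw1.le, ← rpow_add hw1]
    congr 1; ring
  rw [this, div_pow, mul_pow (2 * z)]
  field_simp

lemma phi_b {a b z : ℝ} (ha : 0 < a) (hb : 0 < b) (hz : 0 ≤ z) (hz1 : z < 1) :
    PhiW a b z = ∑' n : ℕ, ENNReal.ofReal ((2 * z) ^ n / (n.factorial * Gamma ((a + b) / 2)) *
      (1 / 2 * (Gamma ((a + n) / 2) * Gamma ((b + n) / 2)))) := by
  have h0 : 0 < Gamma ((a + b) / 2) := Gamma_pos_of_pos (by positivity)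
  have key := lint_hasSum (s := Set.Ioi (0:ℝ)) measurableSet_Ioi
    (f := fun n w => Gamma ((a + b) / 2 + n) / (Gamma ((a + b) / 2) * n.factorial) * (2 * z) ^ n *
      (w ^ (a + n - 1) * (1 + w ^ 2) ^ (-(((a + n) + (b + n)) / 2))))
    (g := fun w => w ^ (a - 1) * (1 + w ^ 2 - 2 * z * w) ^ (-((a + b) / 2)))
    (fun n => by fun_prop) (fun n w hw => by
      have : (0:ℝ) < w := hw
      have hG : 0 < Gamma ((a + b) / 2 + n) := Gamma_pos_of_pos (by positivity)
      positivity) (fun w hw => by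
      have hw : (0:ℝ) < w := hw
      have hx1 : 2 * z * w / (1 + w ^ 2) < 1 := by
        rw [div_lt_one (by positivity)]
        nlinarith [sq_nonneg (1 - w), mul_pos hw (sub_pos.2 hz1)]
      have h := (binom_hasSum (s := (a + b) / 2) (by positivity)
        (x := 2 * z * w / (1 + w ^ 2)) (by positivity) hx1).mul_left
        (w ^ (a - 1) * (1 + w ^ 2) ^ (-((a + b) / 2)) / Gamma ((a + b) / 2))
      refine hasSum_congr' h (fun n => phi_b_alg ha hb hw n) ?_
      have e : 1 + w ^ 2 - 2 * z * w = (1 + w ^ 2) * (1 - 2 * z * w / (1 + w ^ 2)) := by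
        field_simp
      rw [e, mul_rpow (by positivity) (by linarith)]
      field_simp)
  rw [PhiW, key]
  exact tsum_congr (fun n => phi_b_term ha hb hz n)

lemma phi_c {a b z : ℝ} (ha : 0 < a) (hb : 0 < b) (hz : 0 ≤ z) (hz1 : z < 1) :
    PhiW a b z + PhiW a b (-z) = ∑' n : ℕ, 2 * ENNReal.ofReal ((2 * z) ^ (2 * n) /
      ((2 * n).factorial * Gamma ((a + b) / 2)) *
      (1 / 2 * (Gamma ((a + (2 * n : ℕ)) / 2) * Gamma ((b + (2 * n : ℕ)) / 2)))) := by
  have h0 : 0 < Gamma ((a + b) / 2) := Gamma_pos_of_pos (by positivity)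
  have key := lint_hasSum (s := Set.Ioi (0:ℝ)) measurableSet_Ioi
    (f := fun n w => 2 * (Gamma ((a + b) / 2 + (2 * n : ℕ)) / (Gamma ((a + b) / 2) * (2 * n).factorial) * (2 * z) ^ (2 * n) *
      (w ^ (a + (2 * n : ℕ) - 1) * (1 + w ^ 2) ^ (-(((a + (2 * n : ℕ)) + (b + (2 * n : ℕ))) / 2)))))
    (g := fun w => w ^ (a - 1) * (1 + w ^ 2 - 2 * z * w) ^ (-((a + b) / 2)) +
      w ^ (a - 1) * (1 + w ^ 2 - 2 * (-z) * w) ^ (-((a + b) / 2)))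
    (fun n => by fun_prop) (fun n w hw => by
      have : (0:ℝ) < w := hw
      have hG : 0 < Gamma ((a + b) / 2 + (2 * n : ℕ)) := Gamma_pos_of_pos (by positivity)
      positivity) (fun w hw => by
      have hw : (0:ℝ) < w := hw
      have hx0 : 0 ≤ 2 * z * w / (1 + w ^ 2) := by positivity
      have hx1 : 2 * z * w / (1 + w ^ 2) < 1 := by
        rw [div_lt_one (by positivity)]
        nlinarith [sq_nonneg (1 - w), mul_pos hw (sub_pos.2 hz1)]
      have h := (binom_even_hasSum (s := (a + b) / 2) (by positivity)
        (x := 2 * z * w / (1 + w ^ 2)) (by positivity) hx1).mul_left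
        (w ^ (a - 1) * (1 + w ^ 2) ^ (-((a + b) / 2)) / Gamma ((a + b) / 2))
      refine hasSum_congr' h (fun n => ?_) ?_
      · rw [phi_b_alg ha hb hw (2 * n)]; ring
      have e : 1 + w ^ 2 - 2 * z * w = (1 + w ^ 2) * (1 - 2 * z * w / (1 + w ^ 2)) := by
        field_simp
      have e2 : 1 + w ^ 2 - 2 * (-z) * w = (1 + w ^ 2) * (1 + 2 * z * w / (1 + w ^ 2)) := by
        field_simp; ring
      rw [e, e2, mul_rpow (by positivity) (by linarith), mul_rpow (by positivity) (by linarith)]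
      field_simp)
  have hpos : ∀ w ∈ Set.Ioi (0:ℝ), 0 ≤ 1 + w ^ 2 - 2 * z * w ∧ 0 ≤ 1 + w ^ 2 - 2 * (-z) * w := by
    intro w hw
    have hw : (0:ℝ) < w := hw
    constructor <;> nlinarith [sq_nonneg (1 - w), mul_pos hw (sub_pos.2 hz1), mul_nonneg hw.le hz]
  rw [setLIntegral_congr_fun measurableSet_Ioi (g := fun w =>
    ENNReal.ofReal (w ^ (a - 1) * (1 + w ^ 2 - 2 * z * w) ^ (-((a + b) / 2))) +
    ENNReal.ofReal (w ^ (a - 1) * (1 + w ^ 2 - 2 * (-z) * w) ^ (-((a + b) / 2)))) (fun t ht => by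
      have h1 : (0:ℝ) < t := ht
      have := hpos t ht
      exact ENNReal.ofReal_add (mul_nonneg (by positivity) (rpow_nonneg this.1 _))
        (mul_nonneg (by positivity) (rpow_nonneg this.2 _))),
    lintegral_add_left (by fun_prop)] at key
  rw [PhiW, PhiW, key]
  refine tsum_congr (fun n => ?_)
  rw [lint_const_mul (by norm_num), phi_b_term ha hb hz (2 * n)]
  simp


lemma fact_even (j : ℕ) : (2:ℝ) ^ (2 * j) / (2 * j).factorial = √π / (j.factorial * Gamma (1 / 2 + j)) := by
  have h := Real.Gamma_mul_Gamma_add_half (1 / 2 + (j:ℝ))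
  have h1 : 0 < Gamma (1 / 2 + (j:ℝ)) := Gamma_pos_of_pos (by positivity)
  rw [show 1 / 2 + (j:ℝ) + 1 / 2 = j + 1 by ring, Real.Gamma_nat_eq_factorial,
    show 2 * (1 / 2 + (j:ℝ)) = ((2 * j : ℕ) : ℝ) + 1 by push_cast; ring, Real.Gamma_nat_eq_factorial,
    show 1 - (((2 * j : ℕ) : ℝ) + 1) = -((2 * j : ℕ) : ℝ) by ring, rpow_neg two_pos.le, rpow_natCast] at h
  rw [div_eq_div_iff (by positivity) (by positivity), mul_comm (j.factorial : ℝ), h]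
  field_simp

lemma fact_odd (j : ℕ) : (2:ℝ) ^ (2 * j + 1) / (2 * j + 1).factorial = √π / (j.factorial * Gamma (3 / 2 + j)) := by
  have h := Real.Gamma_mul_Gamma_add_half ((j:ℝ) + 1)
  have h1 : 0 < Gamma (3 / 2 + (j:ℝ)) := Gamma_pos_of_pos (by positivity)
  rw [show (j:ℝ) + 1 + 1 / 2 = 3 / 2 + j by ring, Real.Gamma_nat_eq_factorial,
    show 2 * ((j:ℝ) + 1) = ((2 * j + 1 : ℕ) : ℝ) + 1 by push_cast; ring, Real.Gamma_nat_eq_factorial,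
    show 1 - (((2 * j + 1 : ℕ) : ℝ) + 1) = -((2 * j + 1 : ℕ) : ℝ) by ring, rpow_neg two_pos.le, rpow_natCast] at h
  rw [div_eq_div_iff (by positivity) (by positivity), h]
  field_simp

lemma sym_lint (F : ℝ → ENNReal) (hF : Measurable F) :
    ∫⁻ t in Set.Ioo (0:ℝ) 1, F t =
      ∫⁻ z in Set.Ioo (0:ℝ) 1, ENNReal.ofReal (1 / 2) * (F ((1 + z) / 2) + F ((1 - z) / 2)) := by
  have h1 : ∫⁻ t in Set.Ioo (1/2:ℝ) 1, F t =
      ∫⁻ z in Set.Ioo (0:ℝ) 1, ENNReal.ofReal (1 / 2) * F ((1 + z) / 2) := by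
    refine subst_lint (g := fun z => (1 + z) / 2) (g' := fun z => 1 / 2) measurableSet_Ioo ?_ ?_ ?_
    · intro x _
      exact (((hasDerivAt_id x).const_add 1).div_const 2)
    · refine Set.InvOn.bijOn (f' := fun x => 2 * x - 1) ⟨?_, ?_⟩ ?_ ?_
      · intro x _; simp only; ring
      · intro x _; simp only; ring
      · intro x hx; constructor <;> simp only <;> linarith [hx.1, hx.2]
      · intro x hx; constructor <;> simp only <;> linarith [hx.1, hx.2]
    · intro x _
      rw [abs_of_pos (by norm_num)]
  have h2 : ∫⁻ t in Set.Ioo (0:ℝ) (1/2), F t =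
      ∫⁻ z in Set.Ioo (0:ℝ) 1, ENNReal.ofReal (1 / 2) * F ((1 - z) / 2) := by
    refine subst_lint (g := fun z => (1 - z) / 2) (g' := fun z => -1 / 2) measurableSet_Ioo ?_ ?_ ?_
    · intro x _
      exact (((hasDerivAt_id x).const_sub 1).div_const 2)
    · refine Set.InvOn.bijOn (f' := fun x => 1 - 2 * x) ⟨?_, ?_⟩ ?_ ?_
      · intro x _; simp only; ring
      · intro x _; simp only; ring
      · intro x hx; constructor <;> simp only <;> linarith [hx.1, hx.2]
      · intro x hx; constructor <;> simp only <;> linarith [hx.1, hx.2]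
    · intro x _
      rw [abs_of_neg (by norm_num)]; norm_num
  simp_rw [mul_add]
  rw [lintegral_add_left (by fun_prop), ← h1, ← h2,
    ← Set.Ioc_union_Ioo_eq_Ioo (a := (0:ℝ)) (b := 1/2) (c := 1) (by norm_num) (by norm_num),
    lintegral_union measurableSet_Ioo, setLIntegral_congr Ioo_ae_eq_Ioc.symm, add_comm]
  rw [Set.disjoint_left]
  intro x hx hx2
  linarith [hx.2, hx2.1]

lemma phi_measurable (a b : ℝ) : Measurable (PhiW a b) := by
  unfold PhiW
  refine Measurable.lintegral_prod_right' (f := fun p : ℝ × ℝ => ENNReal.ofReal (p.2 ^ (a - 1) * (1 + p.2 ^ 2 - 2 * p.1 * p.2) ^ (-((a + b) / 2)))) ?_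
  fun_prop

lemma watson_3F2 {a b c : ℝ} (ha : 0 < a) (hb : 0 < b) (hc : 0 < c) (h : (a + b) / 2 < c + 1 / 2) :
    ∑' k : ℕ, ENNReal.ofReal (Gamma (a + k) * Gamma (b + k) * Gamma (c + k) /
      (k.factorial * Gamma (2 * c + k) * Gamma ((a + b + 1) / 2 + k))) =
    ENNReal.ofReal (2 ^ (a + b - 2 * c - 1) * (Gamma (a / 2) * Gamma (b / 2) *
      Gamma (c + 1 / 2 - a / 2 - b / 2) / (Gamma (c + 1 / 2 - a / 2) * Gamma (c + 1 / 2 - b / 2)))) := by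
  have hGs : 0 < Gamma ((a + b) / 2) := Gamma_pos_of_pos (by positivity)
  have hGc : 0 < Gamma c := Gamma_pos_of_pos (by positivity)
  set K : ℝ := √π * 2 ^ (1 - (a + b)) / Gamma ((a + b) / 2) with hK
  have hK0 : 0 < K := by positivity
  -- left evaluation
  have L : ENNReal.ofReal (K * Gamma c) * ∑' k : ℕ, ENNReal.ofReal (Gamma (a + k) * Gamma (b + k) * Gamma (c + k) /
      (k.factorial * Gamma (2 * c + k) * Gamma ((a + b + 1) / 2 + k))) =
      ∫⁻ t in Set.Ioo (0:ℝ) 1, ENNReal.ofReal ((t * (1 - t)) ^ (c - 1)) * PhiW a b (2 * t - 1) := by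
    have : ∀ t ∈ Set.Ioo (0:ℝ) 1, ENNReal.ofReal ((t * (1 - t)) ^ (c - 1)) * PhiW a b (2 * t - 1)
        = ∑' n : ℕ, ENNReal.ofReal (K * (Gamma (a + n) * Gamma (b + n) /
          (n.factorial * Gamma ((a + b + 1) / 2 + n))) * (t ^ (c + n - 1) * (1 - t) ^ (c - 1))) := by
      intro t ht
      rw [phi_a ha hb ht.1 ht.2, ← ENNReal.tsum_mul_left]
      have h1 : 0 < 1 - t := by linarith [ht.2]
      refine tsum_congr (fun n => ?_)
      rw [← ENNReal.ofReal_mul (rpow_nonneg (mul_nonneg ht.1.le h1.le) _), mul_rpow ht.1.le h1.le,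
        rpow_shift ht.1]
      congr 1; ring
    rw [setLIntegral_congr_fun measurableSet_Ioo this, lintegral_tsum (fun n => by fun_prop),
      ← ENNReal.tsum_mul_left]
    refine tsum_congr (fun n => ?_)
    have hGa : 0 < Gamma (a + n) := Gamma_pos_of_pos (by positivity)
    have hGb : 0 < Gamma (b + n) := Gamma_pos_of_pos (by positivity)
    have h1 : 0 < Gamma ((a + b + 1) / 2 + n) := Gamma_pos_of_pos (by positivity)
    rw [lint_const_mul (by positivity), beta_lint (by positivity) hc,
      ← ENNReal.ofReal_mul (by positivity), ← ENNReal.ofReal_mul (by positivity),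
      show c + n + c = 2 * c + n by ring]
    congr 1
    field_simp
  -- right evaluation
  have R : ∫⁻ t in Set.Ioo (0:ℝ) 1, ENNReal.ofReal ((t * (1 - t)) ^ (c - 1)) * PhiW a b (2 * t - 1)
      = ENNReal.ofReal (1 / 4 * 4 ^ (1 - c) * √π * Gamma c / Gamma ((a + b) / 2)) *
        ∑' n : ℕ, ENNReal.ofReal (Gamma (a / 2 + n) * Gamma (b / 2 + n) / (n.factorial * Gamma (c + 1 / 2 + n))) := by
    rw [sym_lint _ (by have := phi_measurable a b; fun_prop)]
    have : ∀ z ∈ Set.Ioo (0:ℝ) 1, ENNReal.ofReal (1 / 2) * (ENNReal.ofReal (((1 + z) / 2 * (1 - (1 + z) / 2)) ^ (c - 1)) * PhiW a b (2 * ((1 + z) / 2) - 1) + ENNReal.ofReal (((1 - z) / 2 * (1 - (1 - z) / 2)) ^ (c - 1)) * PhiW a b (2 * ((1 - z) / 2) - 1))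
        = ∑' n : ℕ, ENNReal.ofReal ((1 / 2 * 4 ^ (1 - c) * √π / (n.factorial * Gamma (1 / 2 + n)) / Gamma ((a + b) / 2) * (Gamma (a / 2 + n) * Gamma (b / 2 + n))) * (z ^ (2 * (1 / 2 + n : ℝ) - 1) * (1 - z ^ 2) ^ (c - 1))) := by
      intro z hz
      have hz0 : 0 < z := hz.1
      have hz2 : 0 < 1 - z ^ 2 := by nlinarith [hz.1, hz.2]
      rw [show 2 * ((1 + z) / 2) - 1 = z by ring, show 2 * ((1 - z) / 2) - 1 = -z by ring,
        show (1 + z) / 2 * (1 - (1 + z) / 2) = (1 - z ^ 2) / 4 by ring,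
        show (1 - z) / 2 * (1 - (1 - z) / 2) = (1 - z ^ 2) / 4 by ring, ← mul_add,
        phi_c ha hb hz.1.le hz.2, ENNReal.tsum_mul_left, ← mul_assoc, ← mul_assoc,
        ← ENNReal.tsum_mul_left]
      refine tsum_congr (fun n => ?_)
      rw [show (2 : ENNReal) = ENNReal.ofReal 2 by simp,
        ← ENNReal.ofReal_mul (by positivity), ← ENNReal.ofReal_mul (by positivity),
        ← ENNReal.ofReal_mul (by positivity)]
      congr 1
      have e1 : z ^ (2 * (1 / 2 + n : ℝ) - 1) = z ^ (2 * n) := by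
        rw [← rpow_natCast]; congr 1; push_cast; ring
      have e2 : ((1 - z ^ 2) / 4) ^ (c - 1) = (1 - z ^ 2) ^ (c - 1) * 4 ^ (1 - c) := by
        rw [div_rpow hz2.le (by norm_num), show (1 - c) = -(c - 1) by ring, rpow_neg (by norm_num)]
        rfl
      have e3 : (2 * z) ^ (2 * n) / ((2 * n).factorial * Gamma ((a + b) / 2)) =
          √π / (n.factorial * Gamma (1 / 2 + n)) * z ^ (2 * n) / Gamma ((a + b) / 2) := by
        rw [← fact_even, mul_pow]; field_simp
      rw [e1, e2, e3, show (a + ((2 * n : ℕ):ℝ)) / 2 = a / 2 + n by push_cast; ring,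
        show (b + ((2 * n : ℕ):ℝ)) / 2 = b / 2 + n by push_cast; ring]
      ring
    rw [setLIntegral_congr_fun measurableSet_Ioo this, lintegral_tsum (fun n => by fun_prop),
      ← ENNReal.tsum_mul_left]
    refine tsum_congr (fun n => ?_)
    have hGa : 0 < Gamma (a / 2 + n) := Gamma_pos_of_pos (by positivity)
    have hGb : 0 < Gamma (b / 2 + n) := Gamma_pos_of_pos (by positivity)
    have h1 : 0 < Gamma (1 / 2 + (n:ℝ)) := Gamma_pos_of_pos (by positivity)
    rw [lint_const_mul (by positivity), beta_sq (by positivity) hc,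
      ← ENNReal.ofReal_mul (by positivity), ← ENNReal.ofReal_mul (by positivity),
      show 1 / 2 + n + c = c + 1 / 2 + n by ring]
    congr 1
    field_simp
    norm_num
  rw [gauss_sum (by positivity) (by positivity) (by linarith), ← L] at R
  have hKc : ENNReal.ofReal (K * Gamma c) ≠ 0 := by
    rw [ne_eq, ENNReal.ofReal_eq_zero, not_le]; positivity
  have hmul : ENNReal.ofReal (1 / 4 * 4 ^ (1 - c) * √π * Gamma c / Gamma ((a + b) / 2)) =
      ENNReal.ofReal (K * Gamma c) * ENNReal.ofReal (2 ^ (a + b - 2 * c - 1)) := by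
    rw [← ENNReal.ofReal_mul (by positivity)]
    congr 1
    rw [hK]
    have : (1 / 4 : ℝ) * 4 ^ (1 - c) = 2 ^ (1 - (a + b)) * 2 ^ (a + b - 2 * c - 1) := by
      rw [show (1 / 4 : ℝ) = 2 ^ (-2 : ℝ) by rw [rpow_neg two_pos.le]; norm_num, show (4:ℝ) = 2 ^ (2:ℝ) by norm_num,
        ← rpow_mul two_pos.le, ← rpow_add two_pos, ← rpow_add two_pos]
      congr 1; ring
    rw [this]; ring
  rw [hmul, mul_assoc, ← ENNReal.ofReal_mul (by positivity)] at R
  exact (ENNReal.mul_right_inj hKc ENNReal.ofReal_ne_top).1 R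


lemma bij_mono {g g' : ℝ → ℝ} {a b : ℝ} (hab : a < b) (hc : ContinuousOn g (Set.Icc a b))
    (hd : ∀ x ∈ Set.Ioo a b, HasDerivAt g (g' x) x) (hp : ∀ x ∈ Set.Ioo a b, 0 < g' x) :
    Set.BijOn g (Set.Ioo a b) (Set.Ioo (g a) (g b)) := by
  have hm : StrictMonoOn g (Set.Icc a b) := by
    refine strictMonoOn_of_deriv_pos (convex_Icc a b) hc (fun x hx => ?_)
    rw [interior_Icc] at hx
    rw [(hd x hx).deriv]; exact hp x hx
  refine ⟨?_, (hm.mono Set.Ioo_subset_Icc_self).injOn, intermediate_value_Ioo hab.le hc⟩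
  intro x hx
  have hx' := Set.Ioo_subset_Icc_self hx
  exact ⟨hm (Set.left_mem_Icc.2 hab.le) hx' hx.1, hm hx' (Set.right_mem_Icc.2 hab.le) hx.2⟩

lemma bij_anti {g g' : ℝ → ℝ} {a b : ℝ} (hab : a < b) (hc : ContinuousOn g (Set.Icc a b))
    (hd : ∀ x ∈ Set.Ioo a b, HasDerivAt g (g' x) x) (hp : ∀ x ∈ Set.Ioo a b, g' x < 0) :
    Set.BijOn g (Set.Ioo a b) (Set.Ioo (g b) (g a)) := by
  have hm : StrictAntiOn g (Set.Icc a b) := by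
    refine strictAntiOn_of_deriv_neg (convex_Icc a b) hc (fun x hx => ?_)
    rw [interior_Icc] at hx
    rw [(hd x hx).deriv]; exact hp x hx
  refine ⟨?_, (hm.mono Set.Ioo_subset_Icc_self).injOn, intermediate_value_Ioo' hab.le hc⟩
  intro x hx
  have hx' := Set.Ioo_subset_Icc_self hx
  exact ⟨hm hx' (Set.right_mem_Icc.2 hab.le) hx.2, hm (Set.left_mem_Icc.2 hab.le) hx' hx.1⟩

lemma lint_split {a b c : ℝ} (hab : a < b) (hbc : b < c) (f : ℝ → ENNReal) :
    ∫⁻ x in Set.Ioo a c, f x = (∫⁻ x in Set.Ioo a b, f x) + ∫⁻ x in Set.Ioo b c, f x := by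
  rw [← Set.Ioc_union_Ioo_eq_Ioo hab.le hbc, lintegral_union measurableSet_Ioo,
    setLIntegral_congr Ioo_ae_eq_Ioc.symm]
  rw [Set.disjoint_left]
  intro x hx hx2
  linarith [hx.2, hx2.1]

lemma lint_split_Ioi {a b : ℝ} (hab : a < b) (f : ℝ → ENNReal) :
    ∫⁻ x in Set.Ioi a, f x = (∫⁻ x in Set.Ioo a b, f x) + ∫⁻ x in Set.Ioi b, f x := by
  rw [← Set.Ioc_union_Ioi_eq_Ioi hab.le, lintegral_union measurableSet_Ioi,
    setLIntegral_congr Ioo_ae_eq_Ioc.symm]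
  rw [Set.disjoint_left]
  intro x hx hx2
  have : b < x := hx2
  linarith [hx.2]

noncomputable def Eint (m : ℝ) : ENNReal :=
  ∫⁻ p in Set.Ioo (0:ℝ) 1, ENNReal.ofReal (1 / √(p * (1 - p) * (1 - m * p) * (1 + (1 + m) * p)))

lemma eint_A {m l : ℝ} (hm0 : 0 < m) (hm1 : m < 1) (hl : 0 < l) (hl2 : 3 * l ^ 2 = 1 + m + m ^ 2) :
    Eint m + Eint m = ∫⁻ Y in Set.Ioo 0 (1 / l), ENNReal.ofReal
      (6 / √(Y * (3 - (1 + m + m ^ 2) * Y ^ 2) * (8 - 2 * (1 + m + m ^ 2) * Y ^ 2 - (m + m ^ 2) * Y ^ 3))) := by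
  have hl1 : l < 1 := by nlinarith
  have hlm : m < l := by nlinarith
  have hlh : (1 + m) / 2 < l := by nlinarith [sq_pos_of_pos (sub_pos.2 hm1)]
  have hlm2 : m < l ^ 2 := by nlinarith [sq_pos_of_pos (sub_pos.2 hm1)]
  have he3 : m + m ^ 2 < 2 * l ^ 3 := by
    nlinarith [mul_pos (sub_pos.2 hlh) (sq_pos_of_pos hl), mul_pos (sub_pos.2 hlm2) (by linarith : 0 < 1 + m)]
  have h1l : 1 < 1 / l := by rw [lt_div_iff₀ hl]; linarith
  -- positivity facts
  have hYl : ∀ Y, 0 ≤ Y → Y ≤ 1 / l → l * Y ≤ 1 := fun Y h0 h1 => by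
    rw [le_div_iff₀ hl] at h1; linarith
  have hD : ∀ Y, 0 ≤ Y → Y ≤ 1 / l → 0 < 2 - (m + m ^ 2) * Y ^ 3 := fun Y h0 h1 => by
    have h2 := hYl Y h0 h1
    have h3 : (l * Y) ^ 3 ≤ 1 := pow_le_one₀ (by positivity) h2
    rcases h0.eq_or_lt with h | h
    · rw [← h]; norm_num
    · have : (m + m ^ 2) * Y ^ 3 < 2 * l ^ 3 * Y ^ 3 := mul_lt_mul_of_pos_right he3 (by positivity)
      nlinarith
  set g : ℝ → ℝ := fun Y => Y * (3 - (1 + m + m ^ 2) * Y ^ 2) / (2 - (m + m ^ 2) * Y ^ 3) with hg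
  set g' : ℝ → ℝ := fun Y => 6 * (1 - Y) * (1 - m * Y) * (1 + (1 + m) * Y) / (2 - (m + m ^ 2) * Y ^ 3) ^ 2 with hg'
  have hd : ∀ Y, 0 ≤ Y → Y ≤ 1 / l → HasDerivAt g (g' Y) Y := by
    intro Y h0 h1
    have hDY := hD Y h0 h1
    have hN := (hasDerivAt_id Y).mul ((((hasDerivAt_pow 2 Y).const_mul (1 + m + m ^ 2))).const_sub 3)
    have hDd := (((hasDerivAt_pow 3 Y).const_mul (m + m ^ 2))).const_sub 2
    refine (hN.div hDd hDY.ne').congr_deriv ?_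
    simp only [hg', id]
    field_simp
    simp
    ring
  have hmY : ∀ Y, 0 ≤ Y → Y ≤ 1 / l → 0 < 1 - m * Y := fun Y h0 h1 => by
    have h2 := hYl Y h0 h1
    rcases h0.eq_or_lt with h | h
    · rw [← h]; norm_num
    · nlinarith
  have hg0 : g 0 = 0 := by simp [hg]
  have hg1 : g 1 = 1 := by
    have := hD 1 zero_le_one h1l.le
    simp only [hg]
    rw [div_eq_one_iff_eq this.ne']; ring
  have hgl : g (1 / l) = 0 := by
    simp only [hg]
    rw [← hl2]; field_simp; simp
  have key : ∀ Y ∈ Set.Ioo 0 (1 / l), Y ≠ 1 → ENNReal.ofReal |g' Y| *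
      ENNReal.ofReal (1 / √(g Y * (1 - g Y) * (1 - m * g Y) * (1 + (1 + m) * g Y))) =
      ENNReal.ofReal (6 / √(Y * (3 - (1 + m + m ^ 2) * Y ^ 2) * (8 - 2 * (1 + m + m ^ 2) * Y ^ 2 - (m + m ^ 2) * Y ^ 3))) := by
    intro Y hY hY1
    have hDY := hD Y hY.1.le hY.2.le
    have hmYY := hmY Y hY.1.le hY.2.le
    have h3 : 0 < 1 + (1 + m) * Y := by have := hY.1; positivity
    rw [← ENNReal.ofReal_mul (abs_nonneg _)]
    congr 1
    have e : g Y * (1 - g Y) * (1 - m * g Y) * (1 + (1 + m) * g Y) =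
       (g' Y / 6) ^ 2 * (Y * (3 - (1 + m + m ^ 2) * Y ^ 2) * (8 - 2 * (1 + m + m ^ 2) * Y ^ 2 - (m + m ^ 2) * Y ^ 3)) := by
      have f1 : 1 - g Y = (1 - Y) ^ 2 * (2 + Y) / (2 - (m + m ^ 2) * Y ^ 3) := by
        simp only [hg]
        rw [eq_div_iff hDY.ne', sub_mul, div_mul_cancel₀ _ hDY.ne']; ring
      have f2 : 1 - m * g Y = (1 - m * Y) ^ 2 * (2 + m * Y) / (2 - (m + m ^ 2) * Y ^ 3) := by
        simp only [hg]
        rw [eq_div_iff hDY.ne', sub_mul, mul_assoc, div_mul_cancel₀ _ hDY.ne']; ring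
      have f3 : 1 + (1 + m) * g Y = (1 + (1 + m) * Y) ^ 2 * (2 - (1 + m) * Y) / (2 - (m + m ^ 2) * Y ^ 3) := by
        simp only [hg]
        rw [eq_div_iff hDY.ne', add_mul, mul_assoc, div_mul_cancel₀ _ hDY.ne']; ring
      rw [f1, f2, f3]
      simp only [hg, hg']
      generalize hDD : 2 - (m + m ^ 2) * Y ^ 3 = D at *
      field_simp
      ring
    have hne : g' Y ≠ 0 := by
      simp only [hg']
      have : 1 - Y ≠ 0 := sub_ne_zero.2 hY1.symm
      positivity
    rw [e, Real.sqrt_mul (sq_nonneg _), Real.sqrt_sq_eq_abs, abs_div (g' Y) 6, abs_of_pos (by norm_num : (0:ℝ) < 6)]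
    have : 0 < |g' Y| := abs_pos.2 hne
    field_simp
  rw [lint_split one_pos h1l]
  congr 1
  · unfold Eint
    refine subst_lint measurableSet_Ioo (fun Y hY => hd Y hY.1.le (hY.2.le.trans h1l.le)) ?_
      (fun Y hY => key Y ⟨hY.1, hY.2.trans h1l⟩ hY.2.ne)
    have := bij_mono (g := g) (g' := g') one_pos
      (fun Y hY => (hd Y hY.1 (hY.2.trans h1l.le)).continuousAt.continuousWithinAt)
      (fun Y hY => hd Y hY.1.le (hY.2.le.trans h1l.le)) ?_
    · rwa [hg0, hg1] at this
    · intro Y hY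
      have := hmY Y hY.1.le (hY.2.le.trans h1l.le)
      have h2 := hD Y hY.1.le (hY.2.le.trans h1l.le)
      have h3 := hY.1
      have h4 := sub_pos.2 hY.2
      simp only [hg']
      positivity
  · unfold Eint
    have hY0 : ∀ Y : ℝ, 1 ≤ Y → 0 ≤ Y := fun Y h => by linarith
    refine subst_lint measurableSet_Ioo (fun Y hY => hd Y (hY0 Y hY.1.le) hY.2.le) ?_
      (fun Y hY => key Y ⟨by linarith [hY.1], hY.2⟩ hY.1.ne')
    have := bij_anti (g := g) (g' := g') h1l
      (fun Y hY => (hd Y (hY0 Y hY.1) hY.2).continuousAt.continuousWithinAt)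
      (fun Y hY => hd Y (hY0 Y hY.1.le) hY.2.le) ?_
    · rwa [hgl, hg1] at this
    · intro Y hY
      have := hmY Y (hY0 Y hY.1.le) hY.2.le
      have h2 := hD Y (hY0 Y hY.1.le) hY.2.le
      have h3 : 0 < Y := by linarith [hY.1]
      have h4 := sub_pos.2 hY.1
      have : g' Y = -(6 * (Y - 1) * (1 - m * Y) * (1 + (1 + m) * Y) / (2 - (m + m ^ 2) * Y ^ 3) ^ 2) := by
        simp only [hg']; ring
      rw [this, neg_lt_zero]
      positivity

lemma eint_B {m l v : ℝ} (hl : 0 < l) (hl2 : 3 * l ^ 2 = 1 + m + m ^ 2)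
    (hv : m + m ^ 2 = 2 * l ^ 3 * v) :
    ∫⁻ Y in Set.Ioo 0 (1 / l), ENNReal.ofReal
      (6 / √(Y * (3 - (1 + m + m ^ 2) * Y ^ 2) * (8 - 2 * (1 + m + m ^ 2) * Y ^ 2 - (m + m ^ 2) * Y ^ 3)))
    = ∫⁻ y in Set.Ioo (0:ℝ) 1, ENNReal.ofReal (√3 / √l * ((1 + y ^ 2) / √(y * (1 + y ^ 6 - 2 * v * y ^ 3)))) := by
  have hd : ∀ y, HasDerivAt (fun y : ℝ => 2 * y / (l * (1 + y ^ 2))) (2 * (1 - y ^ 2) / (l * (1 + y ^ 2) ^ 2)) y := by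
    intro y
    have h1 := (hasDerivAt_id y).const_mul 2
    have h2 := ((hasDerivAt_pow 2 y).const_add 1).const_mul l
    refine (h1.div h2 (by positivity)).congr_deriv ?_
    simp
    field_simp
    ring
  refine subst_lint measurableSet_Ioo (fun y _ => hd y) ?_ ?_
  · have := bij_mono (a := (0:ℝ)) (b := 1) one_pos (fun y _ => (hd y).continuousAt.continuousWithinAt) (fun y _ => hd y) ?_
    · convert this using 2
      · simp
      · field_simp; norm_num
    · intro y hy
      have : 0 < 1 - y ^ 2 := by nlinarith [hy.1, hy.2]
      positivity
  · intro y hy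
    have hy0 := hy.1
    have hy2 : 0 < 1 - y ^ 2 := by nlinarith [hy.1, hy.2]
    rw [← ENNReal.ofReal_mul (abs_nonneg _), abs_of_pos (by positivity)]
    congr 1
    have e : 2 * y / (l * (1 + y ^ 2)) * (3 - (1 + m + m ^ 2) * (2 * y / (l * (1 + y ^ 2))) ^ 2) *
        (8 - 2 * (1 + m + m ^ 2) * (2 * y / (l * (1 + y ^ 2))) ^ 2 - (m + m ^ 2) * (2 * y / (l * (1 + y ^ 2))) ^ 3)
        = (4 * (1 - y ^ 2) / (1 + y ^ 2) ^ 3) ^ 2 * (3 * ((y * (1 + y ^ 6 - 2 * v * y ^ 3)) / l)) := by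
      rw [← hl2, hv]; field_simp; ring
    rw [e, Real.sqrt_mul (sq_nonneg _), Real.sqrt_sq (by positivity), Real.sqrt_mul (by norm_num),
      Real.sqrt_div' _ hl.le]
    have h3 : (√3) ^ 2 = 3 := Real.sq_sqrt (by norm_num)
    have h4 : (√l) ^ 2 = l := Real.sq_sqrt hl.le
    have h5 : 0 < √l := Real.sqrt_pos.2 hl
    nth_rewrite 1 [← h4]
    field_simp
    rw [h3]; norm_num

lemma phi_fold (v : ℝ) (hv : -1 < v) (hv1 : v < 1) : PhiW (1 / 6) (5 / 6) v =
    ∫⁻ y in Set.Ioo (0:ℝ) 1, ENNReal.ofReal (3 * ((1 + y ^ 2) / √(y * (1 + y ^ 6 - 2 * v * y ^ 3)))) := by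
  have hQ : ∀ y : ℝ, 0 < y → 0 < 1 + y ^ 6 - 2 * v * y ^ 3 := by
    intro y hy
    have : 0 < y ^ 3 := by positivity
    nlinarith [sq_nonneg (1 - y ^ 3), mul_pos this (sub_pos.2 hv1)]
  unfold PhiW
  rw [lint_split_Ioi one_pos]
  have h1 : ∫⁻ w in Set.Ioo (0:ℝ) 1, ENNReal.ofReal (w ^ (1 / 6 - 1 : ℝ) * (1 + w ^ 2 - 2 * v * w) ^ (-((1 / 6 + 5 / 6) / 2) : ℝ))
      = ∫⁻ y in Set.Ioo (0:ℝ) 1, ENNReal.ofReal (3 * (1 / √(y * (1 + y ^ 6 - 2 * v * y ^ 3)))) := by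
    refine subst_lint (g := fun y => y ^ 3) (g' := fun y => 3 * y ^ 2) measurableSet_Ioo (fun y _ => by simpa using hasDerivAt_pow 3 y) ?_ ?_
    · have := bij_mono (g := fun y : ℝ => y ^ 3) (a := (0:ℝ)) (b := 1) one_pos (by fun_prop) (fun y _ => by simpa using hasDerivAt_pow 3 y)
        (fun y hy => by have := hy.1; positivity)
      simpa using this
    · intro y hy
      have hy0 := hy.1
      have hQy := hQ y hy0
      rw [← ENNReal.ofReal_mul (abs_nonneg _), abs_of_pos (by positivity)]
      congr 1
      have e1 : (y ^ 3) ^ (1 / 6 - 1 : ℝ) = (√y * y ^ 2)⁻¹ := by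
        rw [← rpow_natCast y 3, ← rpow_mul hy0.le, Real.sqrt_eq_rpow, ← rpow_natCast y 2, ← rpow_add hy0, ← rpow_neg hy0.le]
        norm_num
      have e2 : (1 + (y ^ 3) ^ 2 - 2 * v * y ^ 3) ^ (-((1 / 6 + 5 / 6) / 2) : ℝ) = (√(1 + y ^ 6 - 2 * v * y ^ 3))⁻¹ := by
        rw [Real.sqrt_eq_rpow, ← rpow_neg hQy.le]
        ring_nf
      rw [e1, e2, Real.sqrt_mul hy0.le]
      have := Real.sqrt_pos.2 hy0
      field_simp
  have h2 : ∫⁻ w in Set.Ioi (1:ℝ), ENNReal.ofReal (w ^ (1 / 6 - 1 : ℝ) * (1 + w ^ 2 - 2 * v * w) ^ (-((1 / 6 + 5 / 6) / 2) : ℝ))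
      = ∫⁻ y in Set.Ioo (0:ℝ) 1, ENNReal.ofReal (3 * (y ^ 2 / √(y * (1 + y ^ 6 - 2 * v * y ^ 3)))) := by
    have hd : ∀ y ∈ Set.Ioo (0:ℝ) 1, HasDerivAt (fun y : ℝ => (y ^ 3)⁻¹) (-(3 * (y ^ 4)⁻¹)) y := by
      intro y hy
      have hy0 := hy.1
      refine ((hasDerivAt_pow 3 y).inv (by positivity)).congr_deriv ?_
      field_simp
      push_cast; ring
    refine subst_lint measurableSet_Ioo hd ?_ ?_
    · refine Set.InvOn.bijOn (f' := fun x => (x ^ (1 / 3 : ℝ))⁻¹) ⟨?_, ?_⟩ ?_ ?_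
      · intro y hy
        have hy0 := hy.1
        simp only
        rw [inv_rpow (by positivity), inv_inv, ← rpow_natCast y 3, ← rpow_mul hy0.le]
        norm_num
      · intro y hy
        have hy0 : (0:ℝ) < y := lt_trans one_pos hy
        simp only
        rw [inv_pow, inv_inv, ← rpow_natCast _ 3, ← rpow_mul hy0.le]
        norm_num
      · intro y hy
        have hy0 := hy.1
        show 1 < (y ^ 3)⁻¹
        rw [one_lt_inv₀ (by positivity)]
        exact pow_lt_one₀ hy0.le hy.2 (by norm_num)
      · intro y hy
        have hy1 : (1:ℝ) < y := hy
        have hy0 : (0:ℝ) < y := lt_trans one_pos hy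
        refine ⟨by positivity, ?_⟩
        simp only
        exact inv_lt_one_of_one_lt₀ (one_lt_rpow hy1 (by norm_num))
    · intro y hy
      have hy0 := hy.1
      have hQy := hQ y hy0
      rw [← ENNReal.ofReal_mul (abs_nonneg _), abs_neg, abs_of_pos (by positivity)]
      congr 1
      have e1 : ((y ^ 3)⁻¹) ^ (1 / 6 - 1 : ℝ) = √y * y ^ 2 := by
        rw [← rpow_natCast y 3, ← rpow_neg hy0.le, ← rpow_mul hy0.le, Real.sqrt_eq_rpow, ← rpow_natCast y 2, ← rpow_add hy0]
        norm_num
      have e2 : (1 + ((y ^ 3)⁻¹) ^ 2 - 2 * v * (y ^ 3)⁻¹) ^ (-((1 / 6 + 5 / 6) / 2) : ℝ) = y ^ 3 / √(1 + y ^ 6 - 2 * v * y ^ 3) := by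
        have : 1 + ((y ^ 3)⁻¹) ^ 2 - 2 * v * (y ^ 3)⁻¹ = (1 + y ^ 6 - 2 * v * y ^ 3) / (y ^ 3) ^ 2 := by
          field_simp; ring
        rw [this, show (-((1 / 6 + 5 / 6) / 2) : ℝ) = -(1 / 2) by norm_num, rpow_neg (by positivity), ← Real.sqrt_eq_rpow,
          Real.sqrt_div' _ (by positivity), Real.sqrt_sq (by positivity), inv_div]
      rw [e1, e2, Real.sqrt_mul hy0.le]
      have := Real.sqrt_pos.2 hy0
      have h4 : (√y) ^ 2 = y := Real.sq_sqrt hy0.le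
      field_simp
      rw [h4]
  rw [h1, h2, ← lintegral_add_left (by fun_prop)]
  refine setLIntegral_congr_fun measurableSet_Ioo (fun y hy => ?_)
  have hy0 := hy.1
  rw [← ENNReal.ofReal_add (by positivity) (by positivity)]
  congr 1
  ring

lemma eint_val {m l v : ℝ} (hm0 : 0 < m) (hm1 : m < 1) (hl : 0 < l) (hl2 : 3 * l ^ 2 = 1 + m + m ^ 2)
    (hv : m + m ^ 2 = 2 * l ^ 3 * v) (hv0 : 0 < v) (hv1 : v < 1) :
    Eint m = ENNReal.ofReal (1 / (2 * √3 * √l)) * PhiW (1 / 6) (5 / 6) v := by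
  have h := eint_A hm0 hm1 hl hl2
  have h5 : 0 < √l := Real.sqrt_pos.2 hl
  have h3 : (√3) ^ 2 = 3 := Real.sq_sqrt (by norm_num)
  rw [eint_B hl hl2 hv, lint_const_mul (by positivity)] at h
  rw [phi_fold v (by linarith) hv1, lint_const_mul (by norm_num), ← mul_assoc, ← ENNReal.ofReal_mul (by positivity)]
  have e : 1 / (2 * √3 * √l) * 3 = 1 / 2 * (√3 / √l) := by
    field_simp; rw [h3]
  rw [e, ENNReal.ofReal_mul (by norm_num), mul_assoc, ← h, ← two_mul, ← mul_assoc]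
  rw [show (2 : ENNReal) = ENNReal.ofReal 2 by simp, ← ENNReal.ofReal_mul (by norm_num)]
  norm_num


lemma m_to_v : ∫⁻ v in Set.Ioo (0:ℝ) 1, ENNReal.ofReal (1 / √(v * (1 - v ^ 2))) * PhiW (1 / 6) (5 / 6) v
    = ∫⁻ m in Set.Ioo (0:ℝ) 1, ENNReal.ofReal (3 * √2) * (ENNReal.ofReal (1 / √(m * (1 + m))) * Eint m) := by
  set l : ℝ → ℝ := fun m => √((1 + m + m ^ 2) / 3) with hl
  have hpos : ∀ m : ℝ, 0 < 1 + m + m ^ 2 := fun m => by nlinarith [sq_nonneg (m + 1 / 2)]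
  have hl0 : ∀ m, 0 < l m := fun m => Real.sqrt_pos.2 (by have := hpos m; positivity)
  have hl2 : ∀ m, 3 * (l m) ^ 2 = 1 + m + m ^ 2 := fun m => by
    simp only [hl]; rw [Real.sq_sqrt (by have := hpos m; positivity)]; ring
  have hld : ∀ m, HasDerivAt l ((1 + 2 * m) / (6 * l m)) m := by
    intro m
    have h := ((((hasDerivAt_id m).const_add 1).add (hasDerivAt_pow 2 m)).div_const 3).sqrt
      (by have := hpos m; simp; positivity)
    refine h.congr_deriv ?_
    have := hl0 m
    simp only [hl] at this ⊢
    simp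
    field_simp
    ring
  set v : ℝ → ℝ := fun m => (m + m ^ 2) / (2 * (l m) ^ 3) with hv
  set v' : ℝ → ℝ := fun m => (1 - m) * (2 + m) * (1 + 2 * m) / (12 * (l m) ^ 5) with hv'
  have hvd : ∀ m, HasDerivAt v (v' m) m := by
    intro m
    have h1 := (hasDerivAt_id m).add (hasDerivAt_pow 2 m)
    have h2 := ((hld m).pow 3).const_mul 2
    have hlm := hl0 m
    refine (h1.div h2 (by simp; positivity)).congr_deriv ?_
    simp only [hv']
    have e := hl2 m
    simp
    generalize l m = L at *
    field_simp
    have e2 : L ^ 2 = (1 + m + m ^ 2) / 3 := by linarith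
    rw [e2]; ring
  have hl11 : l 1 = 1 := by simp only [hl]; norm_num
  have hbij : Set.BijOn v (Set.Ioo 0 1) (Set.Ioo 0 1) := by
    have := bij_mono (g := v) (g' := v') one_pos (fun m _ => (hvd m).continuousAt.continuousWithinAt)
      (fun m _ => hvd m) (fun m hm => by
        have h1 := hl0 m
        have h2 := hm.1
        have h3 := sub_pos.2 hm.2
        simp only [hv']
        positivity)
    have h0 : v 0 = 0 := by simp [hv]
    have h1 : v 1 = 1 := by simp only [hv, hl11]; norm_num
    rwa [h0, h1] at this
  refine subst_lint measurableSet_Ioo (fun m _ => hvd m) hbij ?_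
  intro m hm
  have hm0 := hm.1
  have hm1 := sub_pos.2 hm.2
  have hL := hl0 m
  have hvm := hbij.mapsTo hm
  have hve : m + m ^ 2 = 2 * (l m) ^ 3 * v m := by
    simp only [hv]; field_simp
  rw [eint_val hm.1 hm.2 hL (hl2 m) hve hvm.1 hvm.2]
  rw [← mul_assoc, ← mul_assoc, ← mul_assoc, ← ENNReal.ofReal_mul (abs_nonneg _),
    ← ENNReal.ofReal_mul (by positivity), ← ENNReal.ofReal_mul (by positivity)]
  congr 2
  have hv'0 : 0 < v' m := by simp only [hv']; positivity
  rw [abs_of_pos hv'0]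
  have e := hl2 m
  have e6 : 27 * (l m) ^ 6 = (1 + m + m ^ 2) ^ 3 := by rw [← e]; ring
  have hw : v m * (1 - v m ^ 2) = ((1 - m) * (2 + m) * (1 + 2 * m) / (l m) ^ 4) ^ 2 * (m * (1 + m) / (6 ^ 2 * (6 * l m))) := by
    simp only [hv]
    generalize l m = L at *
    have : 1 - ((m + m ^ 2) / (2 * L ^ 3)) ^ 2 = ((1 - m) * (2 + m) * (1 + 2 * m)) ^ 2 / (108 * L ^ 6) := by
      rw [eq_div_iff (by positivity)]
      have h3 : ((m + m ^ 2) / (2 * L ^ 3)) ^ 2 * (108 * L ^ 6) = 27 * (m + m ^ 2) ^ 2 := by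
        field_simp; norm_num
      rw [sub_mul, h3]
      linear_combination 4 * e6
    rw [this]
    field_simp
    norm_num
  rw [hw, Real.sqrt_mul (sq_nonneg _), Real.sqrt_sq (by positivity), Real.sqrt_div' _ (by positivity),
    Real.sqrt_mul (by norm_num) (6 * l m), Real.sqrt_sq (by norm_num), Real.sqrt_mul (by norm_num) (l m),
    show (6:ℝ) = 2 * 3 by norm_num, Real.sqrt_mul (by norm_num) 3]
  simp only [hv']
  have h3 : (√3) ^ 2 = 3 := Real.sq_sqrt (by norm_num)
  have hL2 : (√(l m)) ^ 2 = l m := Real.sq_sqrt hL.le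
  have hL3 : 0 < √(l m) := Real.sqrt_pos.2 hL
  have hsq : 0 < √(m * (1 + m)) := Real.sqrt_pos.2 (by positivity)
  generalize √(l m) = q at *
  rw [← hL2]
  field_simp
  rw [h3]; norm_num

lemma v_sum : ∫⁻ v in Set.Ioo (0:ℝ) 1, ENNReal.ofReal (1 / √(v * (1 - v ^ 2))) * PhiW (1 / 6) (5 / 6) v
    = ∑' n : ℕ, ENNReal.ofReal (1 / 4 * (2 ^ n / n.factorial) * (Gamma ((1 / 6 + n) / 2) * Gamma ((5 / 6 + n) / 2)
      * Gamma (n / 2 + 1 / 4) / Gamma (n / 2 + 3 / 4))) := by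
  have : ∀ v ∈ Set.Ioo (0:ℝ) 1, ENNReal.ofReal (1 / √(v * (1 - v ^ 2))) * PhiW (1 / 6) (5 / 6) v
     = ∑' n : ℕ, ENNReal.ofReal ((2 ^ n / n.factorial) * (1 / 2 / √π) * (Gamma ((1 / 6 + n) / 2) * Gamma ((5 / 6 + n) / 2)) *
       (v ^ (2 * ((n:ℝ) / 2 + 1 / 4) - 1) * (1 - v ^ 2) ^ (1 / 2 - 1 : ℝ))) := by
    intro v hv
    have hv0 := hv.1
    have hv2 : 0 < 1 - v ^ 2 := by nlinarith [hv.1, hv.2]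
    rw [phi_b (by norm_num) (by norm_num) hv.1.le hv.2, ← ENNReal.tsum_mul_left]
    refine tsum_congr (fun n => ?_)
    rw [← ENNReal.ofReal_mul (by positivity)]
    congr 1
    have e1 : v ^ (2 * ((n:ℝ) / 2 + 1 / 4) - 1) = v ^ n / √v := by
      rw [show 2 * ((n:ℝ) / 2 + 1 / 4) - 1 = n - 1 / 2 by ring, rpow_sub hv0, rpow_natCast, Real.sqrt_eq_rpow]
    have e2 : (1 - v ^ 2) ^ (1 / 2 - 1 : ℝ) = 1 / √(1 - v ^ 2) := by
      rw [show (1 / 2 - 1 : ℝ) = -(1 / 2) by norm_num, rpow_neg hv2.le, ← Real.sqrt_eq_rpow, one_div]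
    rw [e1, e2, Real.sqrt_mul hv0.le, show ((1 / 6 + 5 / 6 : ℝ) / 2) = 1 / 2 by norm_num, Real.Gamma_one_half_eq, mul_pow]
    have h1 := Real.sqrt_pos.2 hv0
    have h2 := Real.sqrt_pos.2 hv2
    field_simp
  rw [setLIntegral_congr_fun measurableSet_Ioo this, lintegral_tsum (fun n => by fun_prop)]
  refine tsum_congr (fun n => ?_)
  have g1 : 0 < Gamma ((1 / 6 + (n:ℝ)) / 2) := Gamma_pos_of_pos (by positivity)
  have g2 : 0 < Gamma ((5 / 6 + (n:ℝ)) / 2) := Gamma_pos_of_pos (by positivity)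
  rw [lint_const_mul (by positivity), beta_sq (by positivity) (by norm_num), ← ENNReal.ofReal_mul (by positivity),
    Real.Gamma_one_half_eq, show (n:ℝ) / 2 + 1 / 4 + 1 / 2 = n / 2 + 3 / 4 by ring]
  congr 1
  field_simp
  norm_num

lemma sum_val : ∑' n : ℕ, ENNReal.ofReal (1 / 4 * (2 ^ n / n.factorial) * (Gamma ((1 / 6 + n) / 2) * Gamma ((5 / 6 + n) / 2)
      * Gamma (n / 2 + 1 / 4) / Gamma (n / 2 + 3 / 4))) =
    ENNReal.ofReal (π / 8 * (Gamma (1 / 24) * Gamma (5 / 24) / (Gamma (17 / 24) * Gamma (13 / 24)) +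
      Gamma (7 / 24) * Gamma (11 / 24) / (Gamma (23 / 24) * Gamma (19 / 24)))) := by
  have hG : ∀ x : ℝ, 0 < x → 0 < Gamma x := fun x hx => Gamma_pos_of_pos hx
  have hpi : √π * √π = π := Real.mul_self_sqrt Real.pi_pos.le
  have i1 := hG (1 / 24) (by norm_num)
  have i5 := hG (5 / 24) (by norm_num)
  have i7 := hG (7 / 24) (by norm_num)
  have i11 := hG (11 / 24) (by norm_num)
  have i13 := hG (13 / 24) (by norm_num)
  have i17 := hG (17 / 24) (by norm_num)
  have i19 := hG (19 / 24) (by norm_num)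
  have i23 := hG (23 / 24) (by norm_num)
  have w1 := watson_3F2 (a := 1 / 12) (b := 5 / 12) (c := 1 / 4) (by norm_num) (by norm_num) (by norm_num) (by norm_num)
  have w2 := watson_3F2 (a := 7 / 12) (b := 11 / 12) (c := 3 / 4) (by norm_num) (by norm_num) (by norm_num) (by norm_num)
  norm_num at w1 w2
  rw [← tsum_even_add_odd ENNReal.summable ENNReal.summable, mul_add, ENNReal.ofReal_add (by positivity) (by positivity)]
  congr 1
  · have e : ∀ k : ℕ, ENNReal.ofReal (1 / 4 * (2 ^ (2 * k) / (2 * k).factorial) * (Gamma ((1 / 6 + (2 * k : ℕ)) / 2) * Gamma ((5 / 6 + (2 * k : ℕ)) / 2)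
      * Gamma ((2 * k : ℕ) / 2 + 1 / 4) / Gamma ((2 * k : ℕ) / 2 + 3 / 4))) = ENNReal.ofReal (√π / 4) *
       ENNReal.ofReal (Gamma (1 / 12 + k) * Gamma (5 / 12 + k) * Gamma (1 / 4 + k) /
      (k.factorial * Gamma (1 / 2 + k) * Gamma (3 / 4 + k))) := by
      intro k
      rw [fact_even, ← ENNReal.ofReal_mul (by positivity)]
      congr 1
      push_cast
      rw [show (1 / 6 + 2 * (k:ℝ)) / 2 = 1 / 12 + k by ring, show (5 / 6 + 2 * (k:ℝ)) / 2 = 5 / 12 + k by ring,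
        show 2 * (k:ℝ) / 2 + 1 / 4 = 1 / 4 + k by ring, show 2 * (k:ℝ) / 2 + 3 / 4 = 3 / 4 + k by ring]
      have := hG (1 / 2 + (k:ℝ)) (by positivity)
      have := hG (3 / 4 + (k:ℝ)) (by positivity)
      field_simp
    rw [tsum_congr e, ENNReal.tsum_mul_left, w1, ← ENNReal.ofReal_mul (by norm_num), ← ENNReal.ofReal_mul (by positivity)]
    congr 1
    rw [Real.Gamma_one_half_eq]
    linear_combination (1 / 8 * (Gamma (1 / 24) * Gamma (5 / 24) / (Gamma (17 / 24) * Gamma (13 / 24)))) * hpi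
  · have e : ∀ k : ℕ, ENNReal.ofReal (1 / 4 * (2 ^ (2 * k + 1) / (2 * k + 1).factorial) * (Gamma ((1 / 6 + (2 * k + 1 : ℕ)) / 2) * Gamma ((5 / 6 + (2 * k + 1 : ℕ)) / 2)
      * Gamma ((2 * k + 1 : ℕ) / 2 + 1 / 4) / Gamma ((2 * k + 1 : ℕ) / 2 + 3 / 4))) = ENNReal.ofReal (√π / 4) *
       ENNReal.ofReal (Gamma (7 / 12 + k) * Gamma (11 / 12 + k) * Gamma (3 / 4 + k) /
      (k.factorial * Gamma (3 / 2 + k) * Gamma (5 / 4 + k))) := by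
      intro k
      rw [fact_odd, ← ENNReal.ofReal_mul (by positivity)]
      congr 1
      push_cast
      rw [show (1 / 6 + (2 * (k:ℝ) + 1)) / 2 = 7 / 12 + k by ring, show (5 / 6 + (2 * (k:ℝ) + 1)) / 2 = 11 / 12 + k by ring,
        show (2 * (k:ℝ) + 1) / 2 + 1 / 4 = 3 / 4 + k by ring, show (2 * (k:ℝ) + 1) / 2 + 3 / 4 = 5 / 4 + k by ring]
      have := hG (3 / 2 + (k:ℝ)) (by positivity)
      have := hG (5 / 4 + (k:ℝ)) (by positivity)
      field_simp
    rw [tsum_congr e, ENNReal.tsum_mul_left, w2, ← ENNReal.ofReal_mul (by norm_num), ← ENNReal.ofReal_mul (by positivity)]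
    congr 1
    rw [Real.Gamma_one_half_eq]
    linear_combination (1 / 8 * (Gamma (7 / 24) * Gamma (11 / 24) / (Gamma (23 / 24) * Gamma (19 / 24)))) * hpi

lemma half_J : ENNReal.ofReal (3 * √2) * ∫⁻ m in Set.Ioo (0:ℝ) 1, ENNReal.ofReal (1 / √(m * (1 + m))) * Eint m
    = ENNReal.ofReal (π / 8 * (Gamma (1 / 24) * Gamma (5 / 24) / (Gamma (17 / 24) * Gamma (13 / 24)) +
      Gamma (7 / 24) * Gamma (11 / 24) / (Gamma (23 / 24) * Gamma (19 / 24)))) := by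
  rw [← sum_val, ← v_sum, m_to_v, lintegral_const_mul' _ _ ENNReal.ofReal_ne_top]


lemma log_gamma_conv (c : ℝ) (hc : 0 ≤ c) : ConvexOn ℝ (Set.Ioi (0:ℝ)) (fun x => log (Gamma (x / 3 + c))) := by
  refine ⟨convex_Ioi _, fun x hx y hy a b ha hb hab => ?_⟩
  have hx' : (0:ℝ) < x := hx
  have hy' : (0:ℝ) < y := hy
  have := convexOn_log_Gamma.2 (x := x / 3 + c) (y := y / 3 + c) (by simp only [Set.mem_Ioi]; positivity) (by simp only [Set.mem_Ioi]; positivity) ha hb hab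
  simp only [smul_eq_mul, Function.comp_apply] at this ⊢
  convert! this using 3
  linear_combination (-c) * hab

lemma triplication {x : ℝ} (hx : 0 < x) : Gamma (x / 3 + 0) * Gamma (x / 3 + 1 / 3) * Gamma (x / 3 + 2 / 3) * 3 ^ x
    = (Gamma (1 / 3 + 0) * Gamma (1 / 3 + 1 / 3) * Gamma (1 / 3 + 2 / 3) * 3) * Gamma x := by
  have hG : ∀ x : ℝ, 0 < x → 0 < Gamma x := fun x hx => Gamma_pos_of_pos hx
  set C := (Gamma (1 / 3 + 0) * Gamma (1 / 3 + 1 / 3) * Gamma (1 / 3 + 2 / 3) * 3) with hC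
  have hC0 : 0 < C := by
    have := hG (1 / 3 + 0) (by norm_num)
    have := hG (1 / 3 + 1 / 3) (by norm_num)
    have := hG (1 / 3 + 2 / 3) (by norm_num)
    positivity
  have key := Real.eq_Gamma_of_log_convex
    (f := fun x => Gamma (x / 3 + 0) * Gamma (x / 3 + 1 / 3) * Gamma (x / 3 + 2 / 3) * 3 ^ x / C) ?_ ?_ ?_ ?_ hx
  · rw [← key]; field_simp
  · have h := ((((log_gamma_conv 0 le_rfl).add (log_gamma_conv (1 / 3) (by norm_num))).add
      (log_gamma_conv (2 / 3) (by norm_num))).add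
       ((convexOn_id (convex_Ioi (0 : ℝ))).smul (log_pos (show (1:ℝ) < 3 by norm_num)).le)).add_const (- log C)
    refine h.congr ?_
    intro y hy
    have hy : (0:ℝ) < y := hy
    have h1 := (hG (y / 3 + 0) (by positivity)).ne'
    have h2 := (hG (y / 3 + 1 / 3) (by positivity)).ne'
    have h3 := (hG (y / 3 + 2 / 3) (by positivity)).ne'
    have h4 : (3:ℝ) ^ y ≠ 0 := (rpow_pos_of_pos (by norm_num) _).ne'
    simp only [Function.comp_apply, Pi.add_apply, smul_eq_mul, id]
    rw [log_div (by positivity) hC0.ne', log_mul (by positivity) h4, log_mul (by positivity) h3, log_mul h1 h2,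
      log_rpow (by norm_num)]
    ring
  · intro y hy
    rw [show (y + 1) / 3 + 0 = y / 3 + 1 / 3 by ring, show (y + 1) / 3 + 1 / 3 = y / 3 + 2 / 3 by ring,
      show (y + 1) / 3 + 2 / 3 = y / 3 + 0 + 1 by ring, Gamma_add_one (by positivity), rpow_add (by norm_num), rpow_one]
    ring
  · intro y hy
    have h1 := (hG (y / 3 + 0) (by positivity))
    have h2 := (hG (y / 3 + 1 / 3) (by positivity))
    have h3 := (hG (y / 3 + 2 / 3) (by positivity))
    positivity
  · simp only [rpow_one]
    rw [← hC]; exact div_self hC0.ne'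

lemma cos_pi12 : cos (π / 12) = (√6 + √2) / 4 := by
  rw [show π / 12 = π / 3 - π / 4 by ring, cos_sub, cos_pi_div_three, cos_pi_div_four, sin_pi_div_three, sin_pi_div_four,
    show (6:ℝ) = 3 * 2 by norm_num, Real.sqrt_mul (by norm_num)]
  ring
lemma sin_pi12 : sin (π / 12) = (√6 - √2) / 4 := by
  rw [show π / 12 = π / 3 - π / 4 by ring, sin_sub, cos_pi_div_three, cos_pi_div_four, sin_pi_div_three, sin_pi_div_four,
    show (6:ℝ) = 3 * 2 by norm_num, Real.sqrt_mul (by norm_num)]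
  ring

lemma sin_mul_sin' (a b : ℝ) : sin a * sin b = (cos (a - b) - cos (a + b)) / 2 := by
  rw [cos_sub, cos_add]; ring

lemma gamma_ratio : (√3 - 1) * (Gamma (1 / 24) * Gamma (11 / 24)) = √6 * (Gamma (5 / 24) * Gamma (7 / 24)) := by
  have hG : ∀ x : ℝ, 0 < x → 0 < Gamma x := fun x hx => Gamma_pos_of_pos hx
  have hS : ∀ x : ℝ, 0 < x → x < 1 → 0 < sin (π * x) := fun x h0 h1 =>
    sin_pos_of_pos_of_lt_pi (by positivity) (by nlinarith [pi_pos])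
  have t1 := triplication (x := 1 / 8) (by norm_num)
  have t2 := triplication (x := 5 / 8) (by norm_num)
  have p3 : (3:ℝ) ^ (5 / 8 : ℝ) = √3 * 3 ^ (1 / 8 : ℝ) := by
    rw [Real.sqrt_eq_rpow, ← rpow_add (by norm_num)]; norm_num
  have hC0 : 0 < (Gamma (1 / 3 + 0) * Gamma (1 / 3 + 1 / 3) * Gamma (1 / 3 + 2 / 3) * 3) := by
    have := hG (1 / 3 + 0) (by norm_num)
    have := hG (1 / 3 + 1 / 3) (by norm_num)
    have := hG (1 / 3 + 2 / 3) (by norm_num)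
    positivity
  generalize (Gamma (1 / 3 + 0) * Gamma (1 / 3 + 1 / 3) * Gamma (1 / 3 + 2 / 3) * 3) = C at *
  rw [p3] at t2
  have hr : 0 < (3:ℝ) ^ (1 / 8 : ℝ) := by positivity
  generalize (3:ℝ) ^ (1 / 8 : ℝ) = r at *
  have r1 := Real.Gamma_mul_Gamma_one_sub (7 / 24)
  have r2 := Real.Gamma_mul_Gamma_one_sub (11 / 24)
  have r3 := Real.Gamma_mul_Gamma_one_sub (3 / 8)
  have r4 := Real.Gamma_mul_Gamma_one_sub (1 / 8)
  have s1 := hS (7 / 24) (by norm_num) (by norm_num)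
  have s2 := hS (11 / 24) (by norm_num) (by norm_num)
  have s3 := hS (3 / 8) (by norm_num) (by norm_num)
  have s4 := hS (1 / 8) (by norm_num) (by norm_num)
  have e1 : sin (π * (3 / 8)) * sin (π * (7 / 24)) = ((√6 + √2) / 4 + 1 / 2) / 2 := by
    rw [sin_mul_sin', show π * (3 / 8) - π * (7 / 24) = π / 12 by ring, 
      show π * (3 / 8) + π * (7 / 24) = π - π / 3 by ring, cos_pi_sub, cos_pi_div_three, cos_pi12]; ring
  have e2 : sin (π * (1 / 8)) * sin (π * (11 / 24)) = (1 / 2 + (√6 - √2) / 4) / 2 := by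
    rw [sin_mul_sin', show π * (1 / 8) - π * (11 / 24) = -(π / 3) by ring, 
      show π * (1 / 8) + π * (11 / 24) = π / 12 + π / 2 by ring, cos_neg, cos_add_pi_div_two, cos_pi_div_three, sin_pi12]; ring
  have tr : √3 * (√3 - 1) * (sin (π * (3 / 8)) * sin (π * (7 / 24))) = √6 * (sin (π * (1 / 8)) * sin (π * (11 / 24))) := by
    rw [e1, e2, show (6:ℝ) = 3 * 2 by norm_num, Real.sqrt_mul (by norm_num)]
    have h3 : √3 ^ 2 = 3 := Real.sq_sqrt (by norm_num)
    have h2 : √2 ^ 2 = 2 := Real.sq_sqrt (by norm_num)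
    generalize √3 = a at *
    generalize √2 = b at *
    have ha3 : a ^ 3 = 3 * a := by rw [pow_succ, h3]
    ring_nf
    simp only [h3, h2, ha3]
    ring
  norm_num at t1 t2 r1 r2 r3 r4
  have i1 := hG (1 / 24) (by norm_num)
  have i5 := hG (5 / 24) (by norm_num)
  have i7 := hG (7 / 24) (by norm_num)
  have i11 := hG (11 / 24) (by norm_num)
  have i13 := hG (13 / 24) (by norm_num)
  have i17 := hG (17 / 24) (by norm_num)
  have j1 := hG (1 / 8) (by norm_num)
  have j3 := hG (3 / 8) (by norm_num)
  have j5 := hG (5 / 8) (by norm_num)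
  have j7 := hG (7 / 8) (by norm_num)
  have hpi := pi_pos
  generalize sin (π * (3 / 8)) = S3 at *
  generalize sin (π * (1 / 8)) = S4 at *
  generalize sin (π * (7 / 24)) = S1 at *
  generalize sin (π * (11 / 24)) = S2 at *
  rw [eq_div_iff s1.ne'] at r1
  rw [eq_div_iff s2.ne'] at r2
  rw [eq_div_iff s3.ne'] at r3
  rw [eq_div_iff s4.ne'] at r4
  generalize Gamma (1 / 24) = g1 at *
  generalize Gamma (5 / 24) = g5 at *
  generalize Gamma (7 / 24) = g7 at *
  generalize Gamma (11 / 24) = g11 at *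
  generalize Gamma (13 / 24) = g13 at *
  generalize Gamma (17 / 24) = g17 at *
  generalize Gamma (1 / 8) = h1 at *
  generalize Gamma (3 / 8) = h3 at *
  generalize Gamma (5 / 8) = h5 at *
  generalize Gamma (7 / 8) = h7 at *
  have a1 : g1 * h3 * π * r = C * h1 * S1 * g7 := by
    rw [← r1]; linear_combination (g7 * S1) * t1
  have a2 : g5 * π * √3 * r * S3 * h3 = C * S2 * g11 * S4 * h1 := by
    have : π * (g5 * π * √3 * r * S3 * h3) = π * (C * S2 * g11 * S4 * h1) := by
      calc π * (g5 * π * √3 * r * S3 * h3) = (g11 * g13 * S2) * (g5 * (h1 * h7 * S4) * √3 * r * S3 * h3) := by rw [r2, r4]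
        _ = (g5 * g13 * h7 * (√3 * r)) * (g11 * S2 * h1 * S4 * S3 * h3) := by ring
        _ = (C * S2 * g11 * S4 * h1) * (h3 * h5 * S3) := by rw [t2]; ring
        _ = _ := by rw [r3]; ring
    exact mul_left_cancel₀ hpi.ne' this
  have K : g1 * g11 * (S2 * S4) = √3 * (S1 * S3) * (g5 * g7) := by
    have h : 0 < h3 * π * r * C * h1 := by positivity
    refine mul_left_cancel₀ h.ne' ?_
    linear_combination (C * S2 * g11 * S4 * h1) * a1 - (C * h1 * S1 * g7) * a2
  have h : 0 < S2 * S4 := by positivity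
  refine mul_left_cancel₀ h.ne' ?_
  linear_combination (√3 - 1) * K + (g5 * g7) * tr

lemma gamma_final : (π / 8 * (Gamma (1 / 24) * Gamma (5 / 24) / (Gamma (17 / 24) * Gamma (13 / 24)) +
      Gamma (7 / 24) * Gamma (11 / 24) / (Gamma (23 / 24) * Gamma (19 / 24)))) / (6 * √2 * π ^ 2) = 
      ((Real.sqrt 3 - 1) / (192 * π ^ 3)) * Real.Gamma (1 / 24) ^ 2 * Real.Gamma (11 / 24) ^ 2 := by
  have hG : ∀ x : ℝ, 0 < x → 0 < Gamma x := fun x hx => Gamma_pos_of_pos hx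
  have hS : ∀ x : ℝ, 0 < x → x < 1 → 0 < sin (π * x) := fun x h0 h1 =>
    sin_pos_of_pos_of_lt_pi (by positivity) (by nlinarith [pi_pos])
  have r1 := Real.Gamma_mul_Gamma_one_sub (1 / 24)
  have r5 := Real.Gamma_mul_Gamma_one_sub (5 / 24)
  have r7 := Real.Gamma_mul_Gamma_one_sub (7 / 24)
  have r11 := Real.Gamma_mul_Gamma_one_sub (11 / 24)
  have s1 := hS (1 / 24) (by norm_num) (by norm_num)
  have s5 := hS (5 / 24) (by norm_num) (by norm_num)
  have s7 := hS (7 / 24) (by norm_num) (by norm_num)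
  have s11 := hS (11 / 24) (by norm_num) (by norm_num)
  have tr : sin (π * (7 / 24)) * sin (π * (11 / 24)) + sin (π * (1 / 24)) * sin (π * (5 / 24)) = √3 / 2 := by
    rw [sin_mul_sin', sin_mul_sin', show π * (7 / 24) - π * (11 / 24) = -(π / 6) by ring,
      show π * (7 / 24) + π * (11 / 24) = π - π / 4 by ring, show π * (1 / 24) - π * (5 / 24) = -(π / 6) by ring,
      show π * (1 / 24) + π * (5 / 24) = π / 4 by ring, cos_neg, cos_pi_sub, cos_pi_div_six]
    ring
  have gr := gamma_ratio
  rw [show (6:ℝ) = 3 * 2 by norm_num, Real.sqrt_mul (by norm_num)] at gr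
  norm_num at r1 r5 r7 r11
  have i1 := hG (1 / 24) (by norm_num)
  have i5 := hG (5 / 24) (by norm_num)
  have i7 := hG (7 / 24) (by norm_num)
  have i11 := hG (11 / 24) (by norm_num)
  have i13 := hG (13 / 24) (by norm_num)
  have i17 := hG (17 / 24) (by norm_num)
  have i19 := hG (19 / 24) (by norm_num)
  have i23 := hG (23 / 24) (by norm_num)
  have hpi := pi_pos
  have h2 : √2 ^ 2 = 2 := Real.sq_sqrt (by norm_num)
  have h20 : 0 < √2 := by positivity
  rw [mul_comm, ← eq_div_iff i1.ne'] at r1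
  rw [mul_comm, ← eq_div_iff i5.ne'] at r5
  rw [mul_comm, ← eq_div_iff i7.ne'] at r7
  rw [mul_comm, ← eq_div_iff i11.ne'] at r11
  rw [r1, r5, r7, r11]
  generalize sin (π * (1 / 24)) = S1 at *
  generalize sin (π * (5 / 24)) = S5 at *
  generalize sin (π * (7 / 24)) = S7 at *
  generalize sin (π * (11 / 24)) = S11 at *
  generalize Gamma (1 / 24) = g1 at *
  generalize Gamma (5 / 24) = g5 at *
  generalize Gamma (7 / 24) = g7 at *
  generalize Gamma (11 / 24) = g11 at *
  have e : g1 * g5 / (π / S7 / g7 * (π / S11 / g11)) + g7 * g11 / (π / S1 / g1 * (π / S5 / g5))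
     = g1 * g5 * g7 * g11 / π ^ 2 * (√3 / 2) := by
    rw [← tr]; field_simp
  rw [e]
  have e2 : (√3 - 1) / (192 * π ^ 3) * g1 ^ 2 * g11 ^ 2 = (g1 * g11) * (√3 * √2 * (g5 * g7)) / (192 * π ^ 3) := by
    rw [← gr]; ring
  rw [e2]
  field_simp
  rw [h2]; norm_num


lemma z_int {S : ℝ} (hS : 0 < S) : ∫⁻ z in Set.Ioo (-π) π, ENNReal.ofReal (1 / (4 * S + 2 * (1 - cos z)))
    = ENNReal.ofReal (π / (2 * √(S * (1 + S)))) := by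
  obtain ⟨k, hk0, hk⟩ : ∃ k : ℝ, 0 < k ∧ k ^ 2 * (1 + S) = S := 
    ⟨√(S / (1 + S)), by positivity, by rw [Real.sq_sqrt (by positivity)]; field_simp⟩
  have hk2 : √(S * (1 + S)) = S / k := by
    rw [show S * (1 + S) = (S / k) ^ 2 by field_simp; linear_combination hk]
    exact Real.sqrt_sq (by positivity)
  have hb : Set.BijOn (fun u => 2 * arctan (k * u)) Set.univ (Set.Ioo (-π) π) := by
    refine ⟨fun u _ => ?_, fun u _ v _ h => ?_, fun z hz => ?_⟩
    · have := arctan_lt_pi_div_two (k * u)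
      have := neg_pi_div_two_lt_arctan (k * u)
      constructor <;> simp only <;> linarith
    · have : arctan (k * u) = arctan (k * v) := by simp only at h; linarith
      exact mul_left_cancel₀ hk0.ne' (arctan_injective this)
    · refine ⟨tan (z / 2) / k, trivial, ?_⟩
      simp only
      rw [mul_div_cancel₀ _ hk0.ne', arctan_tan (by linarith [hz.1]) (by linarith [hz.2])]
      ring
  rw [subst_lint (F := fun z => ENNReal.ofReal (1 / (4 * S + 2 * (1 - cos z)))) (t := Set.Ioo (-π) π) MeasurableSet.univ (fun u _ => (((hasDerivAt_id u).const_mul k).arctan.const_mul 2)) hb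
    (f := fun u => ENNReal.ofReal (k / (2 * S) * (1 + u ^ 2)⁻¹))]
  · rw [setLIntegral_univ, ← ofReal_integral_eq_lintegral_ofReal (integrable_inv_one_add_sq.const_mul _)
      (Filter.Eventually.of_forall fun u => by positivity), integral_const_mul, integral_univ_inv_one_add_sq, hk2]
    congr 1
    field_simp
  · intro u _
    rw [← ENNReal.ofReal_mul (abs_nonneg _)]
    congr 1
    rw [abs_of_nonneg (by simp; positivity), cos_two_mul, cos_sq_arctan]
    simp
    have : 4 * S + 2 * (1 - (2 * (1 + (k * u) ^ 2)⁻¹ - 1)) = 4 * S * (1 + u ^ 2) / (1 + (k * u) ^ 2) := by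
      field_simp
      linear_combination 4 * u ^ 2 * hk
    rw [this]
    field_simp
    norm_num

lemma x_int (F : ℝ → ENNReal) : ∫⁻ x in Set.Ioo (-π) π, F (sin (x / 2) ^ 2) =
    ∫⁻ p in Set.Ioo (0:ℝ) 1, ENNReal.ofReal (2 / √(p * (1 - p))) * F p := by
  have hd : ∀ x : ℝ, HasDerivAt (fun x => sin (x / 2) ^ 2) (sin (x / 2) * cos (x / 2)) x := by
    intro x
    have := (((hasDerivAt_id x).div_const 2).sin).pow 2
    refine this.congr_deriv ?_
    simp
    ring
  have hpt : ∀ x : ℝ, sin (x / 2) * cos (x / 2) ≠ 0 → 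
      ENNReal.ofReal |sin (x / 2) * cos (x / 2)| * (ENNReal.ofReal (1 / √(sin (x / 2) ^ 2 * (1 - sin (x / 2) ^ 2))) * F (sin (x / 2) ^ 2))
       = F (sin (x / 2) ^ 2) := by
    intro x hx
    rw [← cos_sq', ← mul_pow, Real.sqrt_sq_eq_abs, ← mul_assoc, ← ENNReal.ofReal_mul (abs_nonneg _),
      mul_one_div_cancel (abs_ne_zero.2 hx)]
    simp
  have h1 : ∫⁻ p in Set.Ioo (0:ℝ) 1, ENNReal.ofReal (1 / √(p * (1 - p))) * F p = ∫⁻ x in Set.Ioo 0 π, F (sin (x / 2) ^ 2) := by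
    have pos : ∀ x ∈ Set.Ioo 0 π, 0 < sin (x / 2) * cos (x / 2) := fun x hx =>
      mul_pos (sin_pos_of_pos_of_lt_pi (by linarith [hx.1]) (by linarith [hx.1, hx.2]))
        (cos_pos_of_mem_Ioo ⟨by linarith [hx.1, hx.2], by linarith [hx.2]⟩)
    have hb := bij_mono pi_pos (fun x _ => (hd x).continuousAt.continuousWithinAt) (fun x _ => hd x) pos
    simp only [zero_div, sin_zero, sin_pi_div_two] at hb
    norm_num at hb
    exact subst_lint measurableSet_Ioo (fun x _ => hd x) hb (fun x hx => hpt x (pos x hx).ne')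
  have h2 : ∫⁻ p in Set.Ioo (0:ℝ) 1, ENNReal.ofReal (1 / √(p * (1 - p))) * F p = ∫⁻ x in Set.Ioo (-π) 0, F (sin (x / 2) ^ 2) := by
    have neg : ∀ x ∈ Set.Ioo (-π) 0, sin (x / 2) * cos (x / 2) < 0 := fun x hx =>
      mul_neg_of_neg_of_pos (sin_neg_of_neg_of_neg_pi_lt (by linarith [hx.2]) (by linarith [hx.1, hx.2]))
        (cos_pos_of_mem_Ioo ⟨by linarith [hx.1, hx.2], by linarith [hx.1, hx.2, pi_pos]⟩)
    have hb := bij_anti (neg_lt_zero.2 pi_pos) (fun x _ => (hd x).continuousAt.continuousWithinAt) (fun x _ => hd x) neg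
    simp only [zero_div, sin_zero, neg_div, sin_neg, sin_pi_div_two] at hb
    norm_num at hb
    exact subst_lint measurableSet_Ioo (fun x _ => hd x) hb (fun x hx => hpt x (neg x hx).ne)
  rw [lint_split (neg_lt_zero.2 pi_pos) pi_pos, ← h1, ← h2, ← two_mul, 
    ← lintegral_const_mul' _ _ (by norm_num)]
  refine setLIntegral_congr_fun measurableSet_Ioo (fun p hp => ?_)
  rw [← mul_assoc, show (2:ENNReal) = ENNReal.ofReal 2 by simp, ← ENNReal.ofReal_mul (by norm_num), mul_one_div]

lemma sym_split {h : ℝ → ℝ → ENNReal} (hm : Measurable (Function.uncurry h)) (hs : ∀ p q, h p q = h q p) :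
    ∫⁻ p in Set.Ioo (0:ℝ) 1, ∫⁻ q in Set.Ioo (0:ℝ) 1, h p q = 
     2 * ∫⁻ p in Set.Ioo (0:ℝ) 1, ∫⁻ q in Set.Ioo (0:ℝ) p, h p q := by
  set T : ℝ → ℝ → ENNReal := fun p q => (Set.Iio p).indicator (h p) q with hT
  have hTm : Measurable (Function.uncurry T) := by
    have : Function.uncurry T = Set.indicator {x : ℝ × ℝ | x.2 < x.1} (Function.uncurry h) := by
      ext ⟨p, q⟩
      simp [hT, Set.indicator, Function.uncurry]
    rw [this]
    exact hm.indicator (measurableSet_lt measurable_snd measurable_fst)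
  have e1 : ∀ p ∈ Set.Ioo (0:ℝ) 1, ∫⁻ q in Set.Ioo (0:ℝ) p, h p q = ∫⁻ q in Set.Ioo (0:ℝ) 1, T p q := by
    intro p hp
    simp only [hT]
    rw [setLIntegral_indicator measurableSet_Iio]
    congr 2
    ext q; simp only [Set.mem_inter_iff, Set.mem_Iio, Set.mem_Ioo]
    exact ⟨fun h => ⟨h.2, h.1, h.2.trans hp.2⟩, fun h => ⟨h.2.1, h.1⟩⟩
  have e2 : ∀ p ∈ Set.Ioo (0:ℝ) 1, ∫⁻ q in Set.Ioo (p:ℝ) 1, h p q = ∫⁻ q in Set.Ioo (0:ℝ) 1, T q p := by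
    intro p hp
    have : ∀ q, T q p = (Set.Ioi p).indicator (h p) q := by
      intro q; simp [hT, Set.indicator, hs q p]
    simp only [this]
    rw [setLIntegral_indicator measurableSet_Ioi]
    congr 2
    ext q; simp only [Set.mem_inter_iff, Set.mem_Ioi, Set.mem_Ioo]
    exact ⟨fun h => ⟨h.1, hp.1.trans h.1, h.2⟩, fun h => ⟨h.1, h.2.2⟩⟩
  have e3 : ∀ p ∈ Set.Ioo (0:ℝ) 1, ∫⁻ q in Set.Ioo (0:ℝ) 1, h p q = (∫⁻ q in Set.Ioo (0:ℝ) 1, T p q) + ∫⁻ q in Set.Ioo (0:ℝ) 1, T q p := by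
    intro p hp
    rw [lint_split hp.1 hp.2, e1 p hp, e2 p hp]
  rw [setLIntegral_congr_fun measurableSet_Ioo e3, setLIntegral_congr_fun measurableSet_Ioo e1, 
    lintegral_add_left hTm.lintegral_prod_right, two_mul]
  congr 1
  exact (lintegral_lintegral_swap hTm.aemeasurable).symm

lemma J_val : ∫⁻ p in Set.Ioo (0:ℝ) 1, ∫⁻ q in Set.Ioo (0:ℝ) 1, 
      ENNReal.ofReal (1 / √(p * q * (1 - p) * (1 - q) * (p + q) * (1 + p + q))) = 
     2 * ∫⁻ m in Set.Ioo (0:ℝ) 1, ENNReal.ofReal (1 / √(m * (1 + m))) * Eint m := by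
  rw [sym_split (by unfold Function.uncurry; fun_prop) (fun p q => by congr 3; ring)]
  congr 1
  have e : ∀ p ∈ Set.Ioo (0:ℝ) 1, ∫⁻ q in Set.Ioo (0:ℝ) p, 
      ENNReal.ofReal (1 / √(p * q * (1 - p) * (1 - q) * (p + q) * (1 + p + q)))
      = ∫⁻ m in Set.Ioo (0:ℝ) 1, ENNReal.ofReal (1 / √(m * (1 + m)) * (1/√(p*(1-p)*(1-m*p)*(1+(1+m)*p)))) := by
    intro p hp
    have hp0 := hp.1
    have hb := bij_mono (g := fun m => m * p) (g' := fun _ => p) one_pos (by fun_prop) (fun m _ => hasDerivAt_mul_const p) (fun _ _ => hp0)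
    simp only [zero_mul, one_mul] at hb
    refine subst_lint measurableSet_Ioo (fun m _ => hasDerivAt_mul_const p) hb ?_
    intro m hm
    have hm0 := hm.1
    have hp1 := sub_pos.2 hp.2
    have : 0 < 1 - m * p := by nlinarith [hm.1, hm.2, hp.1, hp.2]
    rw [abs_of_pos hp0, ← ENNReal.ofReal_mul hp0.le]
    congr 1
    rw [show p * (m * p) * (1 - p) * (1 - m * p) * (p + m * p) * (1 + p + m * p) =
       p ^ 2 * ((m * (1 + m)) * (p*(1-p)*(1-m*p)*(1+(1+m)*p))) by ring, Real.sqrt_mul (sq_nonneg p), Real.sqrt_sq hp0.le,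
       Real.sqrt_mul (by positivity)]
    have h1 : 0 < √(m * (1 + m)) := by positivity
    have h2 : 0 < √(p*(1-p)*(1-m*p)*(1+(1+m)*p)) := by positivity
    field_simp
  rw [setLIntegral_congr_fun measurableSet_Ioo e, lintegral_lintegral_swap (by unfold Function.uncurry; fun_prop)]
  refine setLIntegral_congr_fun measurableSet_Ioo (fun m hm => ?_)
  simp only [Eint]
  rw [← lintegral_const_mul' _ _ ENNReal.ofReal_ne_top]
  refine lintegral_congr (fun p => ?_)
  rw [← ENNReal.ofReal_mul (by positivity)]


lemma lint_fin3 (μ : Measure ℝ) [SigmaFinite μ] {f : (Fin 3 → ℝ) → ENNReal} (hf : Measurable f) :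
    ∫⁻ p, f p ∂(Measure.pi fun _ : Fin 3 => μ) = ∫⁻ x, ∫⁻ y, ∫⁻ z, f ![x, y, z] ∂μ ∂μ ∂μ := by
  rw [← (measurePreserving_piFinSuccAbove (fun _ : Fin 3 => μ) 0).symm.lintegral_comp hf, lintegral_prod _ (by fun_prop)]
  refine lintegral_congr (fun x => ?_)
  rw [← (measurePreserving_piFinTwo (fun _ : Fin 2 => μ)).symm.lintegral_comp (by fun_prop), lintegral_prod _ (by fun_prop)]
  refine lintegral_congr (fun y => lintegral_congr (fun z => ?_))
  congr 1
  ext i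
  fin_cases i <;> rfl

lemma eps3_meas : Measurable eps3 := by unfold eps3; fun_prop

noncomputable def cubeM : Measure (Fin 3 → ℝ) := volume.restrict (Set.univ.pi fun _ : Fin 3 => Set.Icc (-π) π)

lemma cubeM_eq : cubeM = Measure.pi fun _ : Fin 3 => volume.restrict (Set.Ioo (-π) π) := by
  unfold cubeM
  rw [volume_pi, Measure.restrict_pi_pi]
  simp only [Measure.restrict_congr_set Ioo_ae_eq_Icc]

lemma G0_eq : ∫⁻ p, ENNReal.ofReal (1 / eps3 p) ∂cubeM = ENNReal.ofReal (2 * π) * 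
    ∫⁻ p in Set.Ioo (0:ℝ) 1, ∫⁻ q in Set.Ioo (0:ℝ) 1, 
      ENNReal.ofReal (1 / √(p * q * (1 - p) * (1 - q) * (p + q) * (1 + p + q))) := by
  rw [cubeM_eq, lint_fin3 _ (by have := eps3_meas; fun_prop)]
  set K : ℝ → ENNReal := fun S => ∫⁻ z in Set.Ioo (-π) π, ENNReal.ofReal (1 / (4 * S + 2 * (1 - cos z))) with hK
  have h1 : ∀ x y : ℝ, ∫⁻ z in Set.Ioo (-π) π, ENNReal.ofReal (1 / eps3 ![x, y, z]) = K (sin (x / 2) ^ 2 + sin (y / 2) ^ 2) := by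
    intro x y
    simp only [hK]
    refine lintegral_congr (fun z => ?_)
    congr 2
    have hx : ∀ x : ℝ, 2 * (1 - cos x) = 4 * sin (x / 2) ^ 2 := by
      intro x
      have := cos_two_mul (x / 2)
      rw [mul_div_cancel₀ _ two_ne_zero, cos_sq'] at this
      rw [this]; ring
    simp [eps3, Fin.sum_univ_three, hx]
    ring
  simp only [h1]
  rw [x_int (fun p => ∫⁻ y in Set.Ioo (-π) π, K (p + sin (y / 2) ^ 2)),
    ← lintegral_const_mul' _ _ ENNReal.ofReal_ne_top]
  refine setLIntegral_congr_fun measurableSet_Ioo (fun p hp => ?_)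
  rw [x_int (fun q => K (p + q)), ← lintegral_const_mul' _ _ ENNReal.ofReal_ne_top, ← lintegral_const_mul' _ _ ENNReal.ofReal_ne_top]
  refine setLIntegral_congr_fun measurableSet_Ioo (fun q hq => ?_)
  have hp0 := hp.1
  have hq0 := hq.1
  have hp1 := sub_pos.2 hp.2
  have hq1 := sub_pos.2 hq.2
  simp only [hK]
  rw [z_int (by positivity), ← ENNReal.ofReal_mul (by positivity), ← ENNReal.ofReal_mul (by positivity), ← ENNReal.ofReal_mul (by positivity)]
  congr 1
  rw [show p * q * (1 - p) * (1 - q) * (p + q) * (1 + p + q) = (p * (1 - p)) * ((q * (1 - q)) * ((p + q) * (1 + (p + q)))) by ring,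
    Real.sqrt_mul (show 0 ≤ p * (1 - p) by positivity), Real.sqrt_mul (show 0 ≤ q * (1 - q) by positivity)]
  have a1 : 0 < √(p * (1 - p)) := by positivity
  have a2 : 0 < √(q * (1 - q)) := by positivity
  have a3 : 0 < √((p + q) * (1 + (p + q))) := by positivity
  generalize √(p * (1 - p)) = w1 at *
  generalize √(q * (1 - q)) = w2 at *
  generalize √((p + q) * (1 + (p + q))) = w3 at *
  field_simp

lemma eps3_nonneg (p : Fin 3 → ℝ) : 0 ≤ eps3 p := 
  Finset.sum_nonneg fun j _ => by linarith [cos_le_one (p j)]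

lemma G0_val : ∫⁻ p, ENNReal.ofReal (1 / eps3 p) ∂cubeM = ENNReal.ofReal ((2 * π) ^ 3 * (((Real.sqrt 3 - 1) / (192 * π ^ 3)) *
        Real.Gamma (1 / 24) ^ 2 * Real.Gamma (11 / 24) ^ 2)) := by
  have h := half_J
  have hpi := pi_pos
  rw [G0_eq, J_val, ← gamma_final]
  have hc : ENNReal.ofReal (3 * √2) ≠ 0 := by simp
  rw [← ENNReal.eq_div_iff hc ENNReal.ofReal_ne_top] at h
  rw [h, ← ENNReal.ofReal_div_of_pos (by positivity), show (2:ENNReal) = ENNReal.ofReal 2 by simp, ← ENNReal.ofReal_mul (by norm_num),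
    ← ENNReal.ofReal_mul (by positivity)]
  congr 1
  generalize (Gamma (1 / 24) * Gamma (5 / 24) / (Gamma (17 / 24) * Gamma (13 / 24)) +
      Gamma (7 / 24) * Gamma (11 / 24) / (Gamma (23 / 24) * Gamma (19 / 24))) = B
  have : 0 < √2 := by positivity
  field_simp
  ring

lemma inv_eps_int : Integrable (fun p => 1 / eps3 p) cubeM := by
  have := eps3_meas
  refine ⟨(show Measurable fun p => 1 / eps3 p by fun_prop).aestronglyMeasurable, ?_⟩
  rw [hasFiniteIntegral_iff_ofReal (Filter.Eventually.of_forall fun p => one_div_nonneg.2 (eps3_nonneg p)), G0_val]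
  exact ENNReal.ofReal_lt_top

lemma green_zero : green3zero 0 = ((Real.sqrt 3 - 1) / (192 * π ^ 3)) *
        Real.Gamma (1 / 24) ^ 2 * Real.Gamma (11 / 24) ^ 2 := by
  have hpi := pi_pos
  have h3 : 0 ≤ √3 - 1 := sub_nonneg.2 (Real.one_le_sqrt.2 (by norm_num))
  have h : ∫ p, 1 / eps3 p ∂cubeM = (2 * π) ^ 3 * (((Real.sqrt 3 - 1) / (192 * π ^ 3)) *
        Real.Gamma (1 / 24) ^ 2 * Real.Gamma (11 / 24) ^ 2) := by
    rw [integral_eq_lintegral_of_nonneg_ae (Filter.Eventually.of_forall fun p => one_div_nonneg.2 (eps3_nonneg p))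
      inv_eps_int.aestronglyMeasurable, G0_val, ENNReal.toReal_ofReal (by positivity)]
  unfold green3zero
  simp only [Pi.zero_apply, Int.cast_zero, mul_zero, Finset.sum_const_zero, cos_zero]
  rw [show (volume.restrict (Set.univ.pi fun _ : Fin 3 => Set.Icc (-π) π)) = cubeM from rfl, h]
  field_simp

lemma cos_eps_int (c : (Fin 3 → ℝ) → ℝ) (hc : Measurable c) (hb : ∀ p, |c p| ≤ 1) : Integrable (fun p => c p / eps3 p) cubeM := by
  have := eps3_meas
  refine inv_eps_int.mono (show Measurable fun p => c p / eps3 p by fun_prop).aestronglyMeasurable (Filter.Eventually.of_forall fun p => ?_)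
  rw [norm_div, norm_div, norm_one]
  gcongr
  exact hb p

lemma cos_perm (i j : Fin 3) : ∫ p, cos (p i) / eps3 p ∂cubeM = ∫ p, cos (p j) / eps3 p ∂cubeM := by
  have h : MeasurePreserving (MeasurableEquiv.piCongrLeft (fun _ : Fin 3 => ℝ) (Equiv.swap i j)) cubeM cubeM := by
    rw [cubeM_eq]
    exact measurePreserving_piCongrLeft (fun _ : Fin 3 => volume.restrict (Set.Ioo (-π) π)) (Equiv.swap i j)
  rw [← h.integral_comp' (fun p => cos (p i) / eps3 p)]
  refine integral_congr_ae (Filter.Eventually.of_forall fun p => ?_)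
  have e : ∀ k, MeasurableEquiv.piCongrLeft (fun _ : Fin 3 => ℝ) (Equiv.swap i j) p k = p (Equiv.swap i j k) := by
    intro k
    have := Equiv.piCongrLeft_apply_apply (fun _ : Fin 3 => ℝ) (Equiv.swap i j) p (Equiv.swap i j k)
    rw [Equiv.swap_apply_self] at this
    exact this
  simp only [eps3, e, Equiv.swap_apply_left]
  congr 1
  exact Equiv.sum_comp (Equiv.swap i j) (fun k => 2 * (1 - cos (p k)))

lemma eps_ne : ∀ᵐ p ∂cubeM, eps3 p ≠ 0 := by
  rw [cubeM_eq]
  have h : ∀ᵐ x ∂(volume.restrict (Set.Ioo (-π) π)), cos x ≠ 1 := by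
    have h0 : ∀ᵐ x ∂(volume.restrict (Set.Ioo (-π) π)), x ≠ 0 := ae_restrict_of_ae (Measure.ae_ne volume 0)
    filter_upwards [h0, ae_restrict_mem measurableSet_Ioo] with x hx hm hc
    exact hx ((cos_eq_one_iff_of_lt_of_lt (by linarith [hm.1, pi_pos]) (by linarith [hm.2, pi_pos])).1 hc)
  have := (Measure.tendsto_eval_ae_ae (μ := fun _ : Fin 3 => volume.restrict (Set.Ioo (-π) π)) (i := 0)).eventually h
  filter_upwards [this] with p hp h0
  apply hp
  simp only [eps3, Fin.sum_univ_three] at h0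
  simp only [Function.eval]
  linarith [cos_le_one (p 0), cos_le_one (p 1), cos_le_one (p 2)]

lemma cube_one : cubeM.real Set.univ = (2 * π) ^ 3 := by
  rw [cubeM_eq, measureReal_def, Measure.pi_univ]
  simp
  rw [ENNReal.toReal_ofReal (by positivity)]
  ring

lemma cos_val (i : Fin 3) : ∫ p, cos (p i) / eps3 p ∂cubeM = (∫ p, 1 / eps3 p ∂cubeM) - (2 * π) ^ 3 / 6 := by
  have hi : ∀ j : Fin 3, Integrable (fun p => cos (p j) / eps3 p) cubeM := fun j =>
    cos_eps_int _ (by fun_prop) (fun p => abs_cos_le_one _)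
  have h : ∫ p, ∑ j : Fin 3, (1 / eps3 p - cos (p j) / eps3 p) ∂cubeM = (2 * π) ^ 3 / 2 := by
    have h1 : ∫ p, (1 / 2 : ℝ) ∂cubeM = (2 * π) ^ 3 / 2 := by
      rw [integral_const, cube_one, smul_eq_mul]; ring
    rw [← h1]
    refine integral_congr_ae ?_
    filter_upwards [eps_ne] with p hp
    have h2 : ∑ j : Fin 3, (1 - cos (p j)) = eps3 p / 2 := by
      rw [eps3, ← Finset.mul_sum]; ring
    simp only [← sub_div, ← Finset.sum_div]
    rw [h2]
    field_simp
  have hI : ∀ j ∈ (Finset.univ : Finset (Fin 3)), Integrable (fun p => 1 / eps3 p - cos (p j) / eps3 p) cubeM :=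
    fun j _ => inv_eps_int.sub (hi j)
  rw [integral_finsetSum _ hI] at h
  simp only [integral_sub inv_eps_int (hi _), fun j => cos_perm j i] at h
  simp at h
  simp
  linarith

lemma three_abs {a b c : ℤ} (h : a.natAbs + b.natAbs + c.natAbs = 1) : (a = 1 ∧ b = 0 ∧ c = 0) ∨ (a = -1 ∧ b = 0 ∧ c = 0) ∨ (a = 0 ∧ b = 1 ∧ c = 0) ∨
      (a = 0 ∧ b = -1 ∧ c = 0) ∨ (a = 0 ∧ b = 0 ∧ c = 1) ∨ (a = 0 ∧ b = 0 ∧ c = -1) := by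
  have h' : (a.natAbs = 1 ∧ b.natAbs = 0 ∧ c.natAbs = 0) ∨ (a.natAbs = 0 ∧ b.natAbs = 1 ∧ c.natAbs = 0) ∨
      (a.natAbs = 0 ∧ b.natAbs = 0 ∧ c.natAbs = 1) := by
    generalize a.natAbs = x at *
    generalize b.natAbs = y at *
    generalize c.natAbs = z at *
    omega
  simp only [Int.natAbs_eq_zero, Int.natAbs_eq_iff] at h'
  push_cast at h'
  tauto

theorem watson_integral :
    green3zero 0 = ((Real.sqrt 3 - 1) / (192 * π ^ 3)) *
        Real.Gamma (1 / 24) ^ 2 * Real.Gamma (11 / 24) ^ 2 ∧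
      ∀ e : Fin 3 → ℤ, (∑ j, (e j).natAbs) = 1 →
        green3zero e = green3zero 0 - 1 / 6 := by
  refine ⟨green_zero, fun e he => ?_⟩
  have hpi := pi_pos
  have hcos : ∃ i, ∀ p : Fin 3 → ℝ, cos (∑ j, p j * (e j : ℝ)) = cos (p i) := by
    rw [Fin.sum_univ_three] at he
    have hc := three_abs he
    simp only [Fin.sum_univ_three]
    rcases hc with ⟨h0, h1, h2⟩ | ⟨h0, h1, h2⟩ | ⟨h0, h1, h2⟩ | ⟨h0, h1, h2⟩ | ⟨h0, h1, h2⟩ | ⟨h0, h1, h2⟩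
    · exact ⟨0, fun p => by simp [h0, h1, h2]⟩
    · exact ⟨0, fun p => by simp [h0, h1, h2]⟩
    · exact ⟨1, fun p => by simp [h0, h1, h2]⟩
    · exact ⟨1, fun p => by simp [h0, h1, h2]⟩
    · exact ⟨2, fun p => by simp [h0, h1, h2]⟩
    · exact ⟨2, fun p => by simp [h0, h1, h2]⟩
  obtain ⟨i, hi⟩ := hcos
  unfold green3zero
  simp only [Pi.zero_apply, Int.cast_zero, mul_zero, Finset.sum_const_zero, cos_zero, hi]
  rw [show (volume.restrict (Set.univ.pi fun _ : Fin 3 => Set.Icc (-π) π)) = cubeM from rfl, cos_val]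
  field_simp
end
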